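/- arXiv:1702.00005 — 5 statements merged into one kernel-verified Lean document; each statement's English description precedes it below -/
import Mathlib

section
/- Let l be a positive integer divisible by 3. Then the subgroup of GL(3,ℂ) generated by E, I and B_{3l,1} = diag(ν, ν, ν⁻²) with ν = exp(2πi/(3l)) (this is the group D_{3l,l}^{(1)}) has order 18·l². -/
open Matrix

/-- The matrix `E` with entries `E₀₁ = E₁₂ = E₂₀ = 1` and all other entries `0`. -/
noncomputable def Ematrix : Matrix (Fin 3) (Fin 3) ℂ := !![0, 1, 0; 0, 0, 1; 1, 0, 0]

/-- The matrix `I` with entries `I₀₂ = I₁₁ = I₂₀ = −1` and all other entries `0`. -/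
noncomputable def Imatrix : Matrix (Fin 3) (Fin 3) ℂ := !![0, 0, -1; 0, -1, 0; -1, 0, 0]

/-- The matrix `B_{n,k} = diag(ν, ν^k, ν^{−1−k})` with `ν = exp(2πi/n)`. -/
noncomputable def Bmatrix (n : ℕ) (k : ℤ) : Matrix (Fin 3) (Fin 3) ℂ :=
  Matrix.diagonal ![Complex.exp (2 * (Real.pi : ℂ) * Complex.I / (n : ℂ)),
    Complex.exp (2 * (Real.pi : ℂ) * Complex.I / (n : ℂ)) ^ k,
    Complex.exp (2 * (Real.pi : ℂ) * Complex.I / (n : ℂ)) ^ (-1 - k)]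

section helpers
variable {G : Type*} [Group G]

theorem aux_closure (E I B C : G) (hE3 : E * E * E = 1) (hI2 : I * I = 1)
    (hC : C = E * B * (E * E)) (hBC : B * C = C * B)
    (hEC : E * C * (E * E) * (B * C) = 1) (hIB : I * B * I * (B * C) = 1)
    (hIC : I * C * I = C) (hIE : I * E * I * E = 1) (g : G) :
    g ∈ Subgroup.closure ({E, I, B} : Set G) ↔
      ∃ x y i j : ℤ, g = B ^ x * C ^ y * E ^ i * I ^ j := by
  have hEi : E * E = E⁻¹ := eq_inv_of_mul_eq_one_left hE3
  have hIi : I⁻¹ = I := inv_eq_of_mul_eq_one_left hI2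
  have comm : Commute B C := hBC
  have s1 : SemiconjBy E B C := by
    show E * B = C * E
    rw [hC, mul_assoc (E * B), hE3, mul_one]
  have s2 : SemiconjBy E C (B * C)⁻¹ := by
    show E * C = (B * C)⁻¹ * E
    rw [← eq_inv_of_mul_eq_one_left hEC, mul_assoc (E * C), hE3, mul_one]
  have s3 : SemiconjBy I B (B * C)⁻¹ := by
    show I * B = (B * C)⁻¹ * I
    rw [← eq_inv_of_mul_eq_one_left hIB, mul_assoc (I * B), hI2, mul_one]
  have s4 : SemiconjBy I C C := by
    show I * C = C * I
    conv_rhs => rw [← hIC, mul_assoc (I * C), hI2, mul_one]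
  have s5 : SemiconjBy I E E⁻¹ := by
    show I * E = E⁻¹ * I
    rw [← eq_inv_of_mul_eq_one_left hIE, mul_assoc (I * E), hI2, mul_one]
  have inv_pow : ∀ n : ℤ, ((B * C)⁻¹) ^ n = B ^ (-n) * C ^ (-n) := fun n => by
    rw [_root_.inv_zpow', comm.mul_zpow]
  have stepE : ∀ g, (∃ x y i j : ℤ, g = B ^ x * C ^ y * E ^ i * I ^ j) →
      ∃ x y i j : ℤ, E * g = B ^ x * C ^ y * E ^ i * I ^ j := by
    rintro _ ⟨x, y, i, j, rfl⟩
    refine ⟨-y, x - y, 1 + i, j, ?_⟩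
    have h := ((s1.zpow_right x).mul_right (s2.zpow_right y)).eq
    rw [inv_pow] at h
    have h2 : C ^ x * (B ^ (-y) * C ^ (-y)) = B ^ (-y) * C ^ (x - y) := by
      rw [← mul_assoc, ← (comm.zpow_zpow (-y) x).eq, mul_assoc, ← _root_.zpow_add, sub_eq_add_neg]
    rw [h2] at h
    rw [← mul_assoc, ← mul_assoc, h, _root_.zpow_add, _root_.zpow_one]
    simp only [mul_assoc]
  have stepI : ∀ g, (∃ x y i j : ℤ, g = B ^ x * C ^ y * E ^ i * I ^ j) →
      ∃ x y i j : ℤ, I * g = B ^ x * C ^ y * E ^ i * I ^ j := by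
    rintro _ ⟨x, y, i, j, rfl⟩
    refine ⟨-x, -x + y, -i, 1 + j, ?_⟩
    have h := (((s3.zpow_right x).mul_right (s4.zpow_right y)).mul_right (s5.zpow_right i)).eq
    rw [inv_pow, _root_.inv_zpow'] at h
    rw [← mul_assoc, h, _root_.zpow_add, _root_.zpow_add, _root_.zpow_one]
    simp only [mul_assoc]
  constructor
  · intro hg
    induction hg using Subgroup.closure_induction_left with
    | one => exact ⟨0, 0, 0, 0, by simp⟩
    | mul_left a ha y hy ih =>
      rcases ha with rfl | rfl | rfl
      · exact stepE _ ih
      · exact stepI _ ih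
      · obtain ⟨x, y, i, j, rfl⟩ := ih
        exact ⟨1 + x, y, i, j, by rw [_root_.zpow_add, _root_.zpow_one]; simp only [mul_assoc]⟩
    | inv_mul_cancel a ha y hy ih =>
      rcases ha with rfl | rfl | rfl
      · rw [← hEi, mul_assoc]
        exact stepE _ (stepE _ ih)
      · rw [hIi]
        exact stepI _ ih
      · obtain ⟨x, y, i, j, rfl⟩ := ih
        exact ⟨-1 + x, y, i, j, by rw [_root_.zpow_add, _root_.zpow_neg_one]; simp only [mul_assoc]⟩
  · rintro ⟨x, y, i, j, rfl⟩
    have mE : E ∈ Subgroup.closure ({E, I, B} : Set G) := Subgroup.subset_closure (by simp)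
    have mI : I ∈ Subgroup.closure ({E, I, B} : Set G) := Subgroup.subset_closure (by simp)
    have mB : B ∈ Subgroup.closure ({E, I, B} : Set G) := Subgroup.subset_closure (by simp)
    have mC : C ∈ Subgroup.closure ({E, I, B} : Set G) := by
      rw [hC]; exact mul_mem (mul_mem mE mB) (mul_mem mE mE)
    exact mul_mem (mul_mem (mul_mem (zpow_mem mB x) (zpow_mem mC y)) (zpow_mem mE i))
      (zpow_mem mI j)

theorem zpow_red (g : G) (n : ℕ) (hn : 0 < n) (h : g ^ n = 1) (x : ℤ) :
    ∃ r : Fin n, g ^ x = g ^ (r : ℕ) := by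
  have hn' : (n : ℤ) ≠ 0 := by exact_mod_cast hn.ne'
  have h0 := Int.emod_nonneg x hn'
  have h1 := Int.emod_lt_of_pos x (by exact_mod_cast hn : (0 : ℤ) < n)
  refine ⟨⟨(x % n).toNat, by omega⟩, ?_⟩
  rw [← _root_.zpow_natCast, Int.toNat_of_nonneg h0]
  conv_lhs => rw [← Int.emod_add_mul_ediv x n, _root_.zpow_add, _root_.zpow_mul, _root_.zpow_natCast, h, _root_.one_zpow,
    mul_one]

theorem aux_card (E I B C : G) (l : ℕ) (hl : 0 < l) (hE3 : E * E * E = 1) (hI2 : I * I = 1)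
    (hC : C = E * B * (E * E)) (hBC : B * C = C * B)
    (hEC : E * C * (E * E) * (B * C) = 1) (hIB : I * B * I * (B * C) = 1)
    (hIC : I * C * I = C) (hIE : I * E * I * E = 1)
    (hB : B ^ (3 * l) = 1) (hCl : C ^ l = B ^ l)
    (hinj : Function.Injective (fun p : Fin (3 * l) × Fin l × Fin 3 × Fin 2 =>
      B ^ (p.1 : ℕ) * C ^ (p.2.1 : ℕ) * E ^ (p.2.2.1 : ℕ) * I ^ (p.2.2.2 : ℕ))) :
    Nat.card ↥(Subgroup.closure ({E, I, B} : Set G)) = 18 * l ^ 2 := by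
  have hset : ((Subgroup.closure ({E, I, B} : Set G) : Subgroup G) : Set G) =
      Set.range (fun p : Fin (3 * l) × Fin l × Fin 3 × Fin 2 =>
      B ^ (p.1 : ℕ) * C ^ (p.2.1 : ℕ) * E ^ (p.2.2.1 : ℕ) * I ^ (p.2.2.2 : ℕ)) := by
    ext g
    rw [SetLike.mem_coe, aux_closure E I B C hE3 hI2 hC hBC hEC hIB hIC hIE]
    constructor
    · rintro ⟨x, y, i, j, rfl⟩
      have hl' : (l : ℤ) ≠ 0 := by exact_mod_cast hl.ne'
      have h0 := Int.emod_nonneg y hl'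
      have h1 := Int.emod_lt_of_pos y (by exact_mod_cast hl : (0 : ℤ) < l)
      have hy : C ^ y = B ^ ((l : ℤ) * (y / l)) * C ^ (y % l).toNat := by
        rw [← _root_.zpow_natCast, Int.toNat_of_nonneg h0]
        conv_lhs => rw [← Int.mul_ediv_add_emod y l, _root_.zpow_add, _root_.zpow_mul, _root_.zpow_natCast, hCl,
          ← _root_.zpow_natCast, ← _root_.zpow_mul]
      obtain ⟨r, hr⟩ := zpow_red B (3 * l) (by omega) hB (x + (l : ℤ) * (y / l))
      obtain ⟨s, hs⟩ := zpow_red E 3 (by omega) (by rw [pow_succ, pow_two, hE3]) i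
      obtain ⟨t, ht⟩ := zpow_red I 2 (by omega) (by rw [pow_two, hI2]) j
      refine ⟨(r, ⟨(y % l).toNat, by omega⟩, s, t), ?_⟩
      simp only
      rw [hy, ← mul_assoc, ← _root_.zpow_add, hr, hs, ht]
    · rintro ⟨p, rfl⟩
      exact ⟨(p.1 : ℕ), (p.2.1 : ℕ), (p.2.2.1 : ℕ), (p.2.2.2 : ℕ), by simp only [_root_.zpow_natCast]⟩
  show Nat.card ((Subgroup.closure ({E, I, B} : Set G) : Subgroup G) : Set G) = _
  rw [hset, Nat.card_range_of_injective hinj]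
  simp
  ring

end helpers

theorem diag_inj (v z : ℂ) (l x y x' y' : ℕ) (hv : IsPrimitiveRoot v (3 * l)) (hl : 0 < l)
    (hvz : v * v * z = 1)
    (hx : x < 3 * l) (hx' : x' < 3 * l) (hy : y < l) (hy' : y' < l)
    (h0 : v ^ x * v ^ y = v ^ x' * v ^ y') (h1 : v ^ x * z ^ y = v ^ x' * z ^ y') :
    x = x' ∧ y = y' := by
  have e : ∀ n : ℕ, v ^ (2 * n) * z ^ n = 1 := fun n => by
    rw [pow_mul, ← mul_pow, pow_two, hvz, one_pow]
  have h2 : v ^ (x + 2 * y') = v ^ (x' + 2 * y) := by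
    calc v ^ (x + 2 * y') = (v ^ x * z ^ y) * v ^ (2 * y') * v ^ (2 * y) := by
          rw [pow_add]; linear_combination (- v ^ x * v ^ (2 * y')) * e y
      _ = v ^ (x' + 2 * y) := by
          rw [h1, pow_add]; linear_combination (v ^ x' * v ^ (2 * y)) * e y'
  rw [← pow_add, ← pow_add] at h0
  have hv0 : v ≠ 0 := hv.ne_zero (by omega)
  have cong : ∀ m n : ℕ, v ^ m = v ^ n → ((3 * l : ℕ) : ℤ) ∣ (n : ℤ) - m := fun m n h => by
    rw [← hv.zpow_eq_one_iff_dvd, zpow_sub₀ hv0, _root_.zpow_natCast, _root_.zpow_natCast, h,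
      div_self (pow_ne_zero n hv0)]
  obtain ⟨a, ha⟩ := cong _ _ h0
  obtain ⟨b, hb⟩ := cong _ _ h2
  push_cast at ha hb
  have hyy : y = y' := by
    have : (y' : ℤ) - y = l * (a - b) := by linarith
    have := Int.eq_zero_of_abs_lt_dvd (m := (l : ℤ)) (x := (y' : ℤ) - y) ⟨_, this⟩
      (by rw [abs_lt]; constructor <;> omega)
    omega
  subst hyy
  have := Int.eq_zero_of_abs_lt_dvd (m := (3 * l : ℤ)) (x := (x' : ℤ) - x) ⟨a, by linarith⟩
      (by rw [abs_lt]; constructor <;> omega)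
  omega

/-- The group `D_{3l,l}^{(1)}`, generated by `E`, `I` and `B_{3l,1}` inside `GL(3,ℂ)`,
has order `18·l²`. -/
theorem D_3ll_order (l : ℕ) (hl : 0 < l) (h3 : 3 ∣ l)
    (E I B : GL (Fin 3) ℂ)
    (hE : E.val = Ematrix) (hI : I.val = Imatrix) (hB : B.val = Bmatrix (3 * l) 1) :
    Nat.card ↥(Subgroup.closure ({E, I, B} : Set (GL (Fin 3) ℂ))) = 18 * l ^ 2 := by
  obtain ⟨v, z, hv, hvz, hB⟩ : ∃ v z : ℂ, IsPrimitiveRoot v (3 * l) ∧ v * v * z = 1 ∧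
      B.val = Matrix.diagonal ![v, v, z] := by
    refine ⟨_, Complex.exp (2 * (Real.pi : ℂ) * Complex.I / ((3 * l : ℕ) : ℂ)) ^ (-1 - 1 : ℤ),
      Complex.isPrimitiveRoot_exp (3 * l) (by omega), ?_, ?_⟩
    rotate_left
    · rw [hB, Bmatrix, _root_.zpow_one]
    · set w := Complex.exp (2 * (Real.pi : ℂ) * Complex.I / ((3 * l : ℕ) : ℂ)) with hw
      have hw0 : w ≠ 0 := Complex.exp_ne_zero _
      rw [show (-1 - 1 : ℤ) = -2 by norm_num, _root_.zpow_neg, zpow_ofNat]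
      field_simp
  have hv0 : v ≠ 0 := hv.ne_zero (by omega)
  have hz0 : z ≠ 0 := right_ne_zero_of_mul_eq_one hvz
  have hvl : v ^ (3 * l) = 1 := hv.pow_eq_one
  have hzl : z ^ l = v ^ l := by
    have : v ^ l * v ^ l * z ^ l = 1 := by rw [← mul_pow, ← mul_pow, hvz, one_pow]
    have h2 : v ^ l * v ^ l * v ^ l = 1 := by rw [← hvl]; ring
    exact mul_left_cancel₀ (mul_ne_zero (pow_ne_zero l hv0) (pow_ne_zero l hv0))
      (this.trans h2.symm)
  have hEE : (E * E).val = !![0, 0, 1; 1, 0, 0; 0, 1, 0] := by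
    rw [Units.val_mul, hE, Ematrix]
    ext i j; fin_cases i <;> fin_cases j <;> simp [Matrix.mul_apply, Matrix.vecMul, dotProduct, Fin.sum_univ_three]
  have hC : (E * B * (E * E)).val = Matrix.diagonal ![v, z, v] := by
    rw [Units.val_mul, Units.val_mul, hEE, hE, hB, Ematrix]
    ext i j; fin_cases i <;> fin_cases j <;> simp [Matrix.mul_apply, Matrix.vecMul, dotProduct, Fin.sum_univ_three]
  obtain ⟨C, hCdef⟩ : ∃ C, C = E * B * (E * E) := ⟨_, rfl⟩
  rw [← hCdef] at hC
  have hz1 : v * z * v = 1 := by rw [← hvz]; ring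
  have hz2 : z * (v * v) = 1 := by rw [← hvz]; ring
  have hz3 : v * (z * v) = 1 := by rw [← hvz]; ring
  have hz4 : v * (v * z) = 1 := by rw [← hvz]; ring
  apply aux_card E I B C l hl ?_ ?_ hCdef ?_ ?_ ?_ ?_ ?_ ?_ ?_ ?_
  · apply Units.ext
    rw [Units.val_mul, hEE, hE, Ematrix]
    ext i j; fin_cases i <;> fin_cases j <;> simp [Matrix.mul_apply, Matrix.vecMul, dotProduct, Fin.sum_univ_three]
  · apply Units.ext
    rw [Units.val_mul, hI, Imatrix]
    ext i j; fin_cases i <;> fin_cases j <;> simp [Matrix.mul_apply, Matrix.vecMul, dotProduct, Fin.sum_univ_three]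
  · apply Units.ext
    rw [Units.val_mul, Units.val_mul, hB, hC, diagonal_mul_diagonal, diagonal_mul_diagonal]
    congr 1; ext i; exact mul_comm _ _
  · apply Units.ext
    simp only [Units.val_mul, hB, hC, hE, Ematrix]
    ext i j; fin_cases i <;> fin_cases j <;>
      simp [Matrix.mul_apply, Matrix.vecMul, dotProduct, Fin.sum_univ_three, hz1, hz2, hz3, hz4]
  · apply Units.ext
    simp only [Units.val_mul, hB, hC, hI, Imatrix]
    ext i j; fin_cases i <;> fin_cases j <;>
      simp [Matrix.mul_apply, Matrix.vecMul, dotProduct, Fin.sum_univ_three, hz1, hz2, hz3, hz4]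
  · apply Units.ext
    simp only [Units.val_mul, hC, hI, Imatrix]
    ext i j; fin_cases i <;> fin_cases j <;>
      simp [Matrix.mul_apply, Matrix.vecMul, dotProduct, Fin.sum_univ_three]
  · apply Units.ext
    simp only [Units.val_mul, hE, hI, Imatrix, Ematrix]
    ext i j; fin_cases i <;> fin_cases j <;>
      simp [Matrix.mul_apply, Matrix.vecMul, dotProduct, Fin.sum_univ_three]
  · apply Units.ext
    rw [Units.val_pow_eq_pow_val, hB, diagonal_pow]
    have hz : z ^ (3 * l) = 1 := by rw [mul_comm, pow_mul, hzl, ← pow_mul, mul_comm, hvl]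
    ext i j; fin_cases i <;> fin_cases j <;> simp [hvl, hz]
  · apply Units.ext
    rw [Units.val_pow_eq_pow_val, Units.val_pow_eq_pow_val, hB, hC, diagonal_pow, diagonal_pow]
    ext i j; fin_cases i <;> fin_cases j <;> simp [hzl]
  · rintro ⟨x, y, i, j⟩ ⟨x', y', i', j'⟩ h
    simp only at h
    have hd : ∀ a b : ℕ, (B ^ a * C ^ b).val =
        Matrix.diagonal ![v ^ a * v ^ b, v ^ a * z ^ b, z ^ a * v ^ b] := fun a b => by
      rw [Units.val_mul, Units.val_pow_eq_pow_val, Units.val_pow_eq_pow_val, hB, hC, diagonal_pow,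
        diagonal_pow, diagonal_mul_diagonal]
      congr 1; ext i; fin_cases i <;> simp
    have key : ∀ m n : Fin 3,
        ![v ^ (x : ℕ) * v ^ (y : ℕ), v ^ (x : ℕ) * z ^ (y : ℕ), z ^ (x : ℕ) * v ^ (y : ℕ)] m *
          (E ^ (i : ℕ) * I ^ (j : ℕ)).val m n =
        ![v ^ (x' : ℕ) * v ^ (y' : ℕ), v ^ (x' : ℕ) * z ^ (y' : ℕ),
          z ^ (x' : ℕ) * v ^ (y' : ℕ)] m * (E ^ (i' : ℕ) * I ^ (j' : ℕ)).val m n := by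
      intro m n
      have := congrArg (fun g : GL (Fin 3) ℂ => g.val m n) h
      simp only [mul_assoc (B ^ _ * C ^ _)] at this
      simpa only [Units.val_mul (B ^ _ * C ^ _), hd, diagonal_mul] using this
    have hij : i = i' ∧ j = j' := by
      have k1 := key 0 0
      have k2 := key 0 1
      have k3 := key 0 2
      have k4 := key 1 0
      have k5 := key 1 1
      have k6 := key 1 2
      clear key h hd
      fin_cases i <;> fin_cases j <;> fin_cases i' <;> fin_cases j' <;>
        first
        | exact ⟨rfl, rfl⟩
        | (exfalso
           simp [pow_two, hEE, hE, hI, Ematrix, Imatrix, Matrix.mul_apply, Matrix.vecMul, dotProduct, Fin.sum_univ_three,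
            hv0, hz0] at k1 k2 k3 k4 k5 k6)
    obtain ⟨rfl, rfl⟩ := hij
    have hne : ∀ m : Fin 3, ∃ n, (E ^ (i : ℕ) * I ^ (j : ℕ)).val m n ≠ 0 := by
      intro m
      by_contra hcon
      push Not at hcon
      have hdet : (E ^ (i : ℕ) * I ^ (j : ℕ)).val.det = 0 := Matrix.det_eq_zero_of_row_eq_zero m hcon
      have hu := (Matrix.isUnit_iff_isUnit_det _).1 (E ^ (i : ℕ) * I ^ (j : ℕ)).isUnit
      rw [hdet] at hu
      exact not_isUnit_zero hu
    obtain ⟨n0, hn0⟩ := hne 0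
    obtain ⟨n1, hn1⟩ := hne 1
    have e0 := mul_right_cancel₀ hn0 (key 0 n0)
    have e1 := mul_right_cancel₀ hn1 (key 1 n1)
    simp at e0 e1
    obtain ⟨hx, hy⟩ := diag_inj v z l x y x' y' hv hl hvz x.2 x'.2 y.2 y'.2 e0 e1
    rw [Fin.ext hx, Fin.ext hy]
end

section
/- Let n be a positive integer divisible by 3, let m ≥ 2 be an integer, and let j be a positive integer. Then the subgroup of GL(3,ℂ) generated by E, L_n and −F_{m,j} (this is the group Δ′(6n², m, j)) has order 3^m·2^j·n². -/
open Matrix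

/-- The matrix `L_n = diag(1, ν, ν⁻¹)` with `ν = exp(2πi/n)`. -/
noncomputable def Lmatrix (n : ℕ) : Matrix (Fin 3) (Fin 3) ℂ :=
  Matrix.diagonal ![1, Complex.exp (2 * (Real.pi : ℂ) * Complex.I / (n : ℂ)),
    (Complex.exp (2 * (Real.pi : ℂ) * Complex.I / (n : ℂ)))⁻¹]

/-- The matrix `F_{m,j}`, with entries `−ξ` in positions `(0,2)`, `(1,1)`, `(2,0)` and `0`
elsewhere, where `ξ = exp(2πi/(3^m·2^j))`. -/
noncomputable def Fmatrix (m j : ℕ) : Matrix (Fin 3) (Fin 3) ℂ :=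
  (-(Complex.exp (2 * (Real.pi : ℂ) * Complex.I / ((3 : ℂ) ^ m * (2 : ℂ) ^ j)))) •
    (!![0, 0, 1; 0, 1, 0; 1, 0, 0] : Matrix (Fin 3) (Fin 3) ℂ)

namespace DeltaPrime

/-- Diagonal matrices in `GL₃`. -/
noncomputable def dg (x y : ℂˣ) : GL (Fin 3) ℂ where
  val := Matrix.diagonal ![(x : ℂ), y, ((x * y)⁻¹ : ℂˣ)]
  inv := Matrix.diagonal ![((x⁻¹ : ℂˣ) : ℂ), (y⁻¹ : ℂˣ), (x * y : ℂˣ)]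
  val_inv := by
    rw [Matrix.diagonal_mul_diagonal, ← Matrix.diagonal_one]
    congr 1; funext i; fin_cases i <;> simp; field_simp
  inv_val := by
    rw [Matrix.diagonal_mul_diagonal, ← Matrix.diagonal_one]
    congr 1; funext i; fin_cases i <;> simp; field_simp

lemma dg_mul (x y z w : ℂˣ) : dg x y * dg z w = dg (x * z) (y * w) := by
  apply Units.ext
  simp only [dg, Units.val_mul, Matrix.diagonal_mul_diagonal]
  congr 1; funext i; fin_cases i <;> simp <;> ring

lemma dg_one : dg 1 1 = 1 := by
  apply Units.ext
  simp only [dg, Units.val_one]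
  rw [← Matrix.diagonal_one]
  congr 1; funext i; fin_cases i <;> simp

/-- `dg` as a monoid homomorphism. -/
noncomputable def dgHom : ℂˣ × ℂˣ →* GL (Fin 3) ℂ where
  toFun p := dg p.1 p.2
  map_one' := dg_one
  map_mul' p q := (dg_mul _ _ _ _).symm

lemma dg_inv (x y : ℂˣ) : (dg x y)⁻¹ = dg x⁻¹ y⁻¹ := (map_inv dgHom (x, y)).symm

lemma dg_zpow (x y : ℂˣ) (z : ℤ) : (dg x y) ^ z = dg (x ^ z) (y ^ z) :=
  (map_zpow dgHom (x, y) z).symm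

lemma dg_inj {x y z w : ℂˣ} (h : dg x y = dg z w) : x = z ∧ y = w := by
  have h' := congrArg Units.val h
  simp only [dg] at h'
  have h0 := congrFun (congrFun h' 0) 0
  have h1 := congrFun (congrFun h' 1) 1
  simp at h0 h1
  exact ⟨Units.ext h0, Units.ext h1⟩

section
variable {E F : GL (Fin 3) ℂ} {ξ : ℂˣ}

lemma E_dg (hE : E.val = Ematrix) (x y : ℂˣ) : E * dg x y = dg y (x * y)⁻¹ * E := by
  apply Units.ext
  simp only [Units.val_mul, hE, dg, Ematrix]
  ext i k
  fin_cases i <;> fin_cases k <;> simp [Matrix.mul_apply, Fin.sum_univ_three]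

lemma E_cube (hE : E.val = Ematrix) : E ^ 3 = 1 := by
  apply Units.ext
  simp only [pow_succ, pow_zero, one_mul, Units.val_mul, hE, Ematrix]
  ext i k
  fin_cases i <;> fin_cases k <;> simp

lemma F_dg (hF : F.val = (ξ : ℂ) • (!![0, 0, 1; 0, 1, 0; 1, 0, 0] : Matrix (Fin 3) (Fin 3) ℂ))
    (x y : ℂˣ) : F * dg x y = dg (x * y)⁻¹ y * F := by
  apply Units.ext
  simp only [Units.val_mul, hF, dg]
  ext i k
  fin_cases i <;> fin_cases k <;> simp [Matrix.mul_apply, Fin.sum_univ_three] <;>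
    field_simp

lemma F_E (hE : E.val = Ematrix)
    (hF : F.val = (ξ : ℂ) • (!![0, 0, 1; 0, 1, 0; 1, 0, 0] : Matrix (Fin 3) (Fin 3) ℂ)) :
    F * E = E⁻¹ * F := by
  rw [eq_inv_mul_iff_mul_eq]
  apply Units.ext
  simp only [Units.val_mul, hF, hE, Ematrix]
  ext i k
  fin_cases i <;> fin_cases k <;> simp

/-- Scalar matrices. -/
noncomputable def sc (x : ℂˣ) : GL (Fin 3) ℂ :=
  Units.map (algebraMap ℂ (Matrix (Fin 3) (Fin 3) ℂ)).toMonoidHom x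

lemma sc_val (x : ℂˣ) : (sc x).val = (x : ℂ) • (1 : Matrix (Fin 3) (Fin 3) ℂ) := by
  simp [sc, Algebra.algebraMap_eq_smul_one]

lemma sc_comm (x : ℂˣ) (g : GL (Fin 3) ℂ) : sc x * g = g * sc x := by
  apply Units.ext
  simp [sc_val]

lemma sc_zpow (x : ℂˣ) (z : ℤ) : sc x ^ z = sc (x ^ z) := (map_zpow _ x z).symm

lemma sc_eq_dg (x : ℂˣ) (h : x ^ 3 = 1) : sc x = dg x x := by
  apply Units.ext
  rw [sc_val]
  have h3 : (x * x)⁻¹ = x := by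
    rw [inv_eq_iff_mul_eq_one, ← h, pow_succ, pow_two]
  simp only [dg, h3]
  ext i k
  fin_cases i <;> fin_cases k <;> simp

lemma F_sq (hF : F.val = (ξ : ℂ) • (!![0, 0, 1; 0, 1, 0; 1, 0, 0] : Matrix (Fin 3) (Fin 3) ℂ)) :
    F ^ (2 : ℤ) = sc (ξ ^ 2) := by
  apply Units.ext
  have : F ^ (2 : ℤ) = F * F := zpow_two F
  rw [this, sc_val, Units.val_mul, hF]
  ext i k
  fin_cases i <;> fin_cases k <;> simp <;> ring

lemma F_even (hF : F.val = (ξ : ℂ) • (!![0, 0, 1; 0, 1, 0; 1, 0, 0] : Matrix (Fin 3) (Fin 3) ℂ))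
    (t : ℤ) : F ^ (2 * t) = sc (ξ ^ (2 * t)) := by
  rw [_root_.zpow_mul, F_sq hF, sc_zpow, _root_.zpow_mul]; norm_cast

lemma E_mod (hE : E.val = Ematrix) (i : ℤ) : E ^ i = E ^ (i % 3) := by
  conv_lhs => rw [← Int.emod_add_mul_ediv i 3, _root_.zpow_add, _root_.zpow_mul]
  have : E ^ (3 : ℤ) = 1 := by exact_mod_cast E_cube hE
  rw [this]; simp

lemma key_even (hE : E.val = Ematrix) (x y z : ℂˣ) (i : ℤ)
    (h : dg x y * E ^ i * sc z = 1) : i % 3 = 0 ∧ x * z = 1 ∧ y * z = 1 ∧ z ^ 3 = 1 := by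
  rw [E_mod hE] at h
  have hi : i % 3 = 0 ∨ i % 3 = 1 ∨ i % 3 = 2 := by omega
  have h' := congrArg Units.val h
  rcases hi with hi | hi | hi
  · refine ⟨hi, ?_⟩
    rw [hi] at h'
    simp only [zpow_zero, mul_one, Units.val_mul, sc_val, dg, Units.val_one] at h'
    have h0 := congrFun (congrFun h' 0) 0
    have h1 := congrFun (congrFun h' 1) 1
    have h2 := congrFun (congrFun h' 2) 2
    simp at h0 h1 h2
    have a0 : x * z = 1 := by apply Units.ext; simpa [mul_comm] using h0
    have a1 : y * z = 1 := by apply Units.ext; simpa [mul_comm] using h1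
    have a2 : (x * y)⁻¹ * z = 1 := by apply Units.ext; simpa [mul_comm] using h2
    refine ⟨a0, a1, ?_⟩
    calc z ^ 3 = (x * z) * (y * z) * ((x * y)⁻¹ * z) := by
          apply Units.ext
          push_cast
          field_simp
      _ = 1 := by rw [a0, a1, a2]; simp
  · exfalso
    rw [hi] at h'
    simp only [zpow_one, Units.val_mul, sc_val, dg, Units.val_one, hE, Ematrix] at h'
    have h0 := congrFun (congrFun h' 0) 0
    simp [Matrix.mul_apply, Fin.sum_univ_three] at h0
  · exfalso
    have : E ^ (2 : ℤ) = E * E := zpow_two E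
    rw [hi, this] at h'
    simp only [Units.val_mul, sc_val, dg, Units.val_one, hE, Ematrix] at h'
    have h0 := congrFun (congrFun h' 0) 0
    simp [Matrix.mul_apply, Fin.sum_univ_three] at h0

lemma key_odd (hE : E.val = Ematrix)
    (hF : F.val = (ξ : ℂ) • (!![0, 0, 1; 0, 1, 0; 1, 0, 0] : Matrix (Fin 3) (Fin 3) ℂ))
    (x y z : ℂˣ) (i : ℤ)
    (h : dg x y * E ^ i * (sc z * F) = 1) : False := by
  rw [E_mod hE] at h
  have hi : i % 3 = 0 ∨ i % 3 = 1 ∨ i % 3 = 2 := by omega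
  have h' := congrArg Units.val h
  rcases hi with hi | hi | hi
  · rw [hi] at h'
    simp only [zpow_zero, mul_one, Units.val_mul, sc_val, dg, Units.val_one, hF] at h'
    have h0 := congrFun (congrFun h' 0) 0
    simp [Matrix.mul_apply, Fin.sum_univ_three] at h0
  · rw [hi] at h'
    simp only [zpow_one, Units.val_mul, sc_val, dg, Units.val_one, hE, Ematrix, hF] at h'
    have h0 := congrFun (congrFun h' 0) 0
    simp [Matrix.mul_apply, Fin.sum_univ_three] at h0
  · have : E ^ (2 : ℤ) = E * E := zpow_two E
    rw [hi, this] at h'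
    simp only [Units.val_mul, sc_val, dg, Units.val_one, hE, Ematrix, hF] at h'
    have h0 := congrFun (congrFun h' 1) 1
    simp [Matrix.mul_apply, Fin.sum_univ_three] at h0

end

/-- The abstract counting statement. -/
lemma main {E L F : GL (Fin 3) ℂ} {ξ ν : ℂˣ} {n M q : ℕ} (hn : n = 3 * q) (hq : 0 < q)
    (hM0 : 0 < M) (hM : Even M) (hν : IsPrimitiveRoot ν n) (hξ : IsPrimitiveRoot ξ (3 * M))
    (hνξ : ξ ^ M = ν ^ q)
    (hE : E.val = Ematrix) (hL : L = dg 1 ν)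
    (hF : F.val = (ξ : ℂ) • (!![0, 0, 1; 0, 1, 0; 1, 0, 0] : Matrix (Fin 3) (Fin 3) ℂ)) :
    Nat.card ↥(Subgroup.closure ({E, L, F} : Set (GL (Fin 3) ℂ))) = n * (n * (3 * M)) := by
  set d : ℤ → ℤ → GL (Fin 3) ℂ := fun a b => dg (ν ^ a) (ν ^ b) with hd
  have d_mul : ∀ a b a' b', d a b * d a' b' = d (a + a') (b + b') := by
    intro a b a' b'; simp only [hd, dg_mul, _root_.zpow_add]
  have d_E : ∀ a b, E * d a b = d b (-a - b) * E := by
    intro a b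
    simp only [hd, E_dg hE]
    congr 2; rw [← _root_.zpow_add, ← _root_.zpow_neg]; congr 1; ring
  have d_F : ∀ a b, F * d a b = d (-a - b) b * F := by
    intro a b
    simp only [hd, F_dg hF]
    congr 2; rw [← _root_.zpow_add, ← _root_.zpow_neg]; congr 1; ring
  have d_E' : ∀ a b, E⁻¹ * d a b = d (-a - b) a * E⁻¹ := by
    intro a b
    rw [inv_mul_eq_iff_eq_mul, ← mul_assoc, d_E, mul_assoc, mul_inv_cancel, mul_one]
    congr 1; ring
  have d_F' : ∀ a b, F⁻¹ * d a b = d (-a - b) b * F⁻¹ := by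
    intro a b
    rw [inv_mul_eq_iff_eq_mul, ← mul_assoc, d_F, mul_assoc, mul_inv_cancel, mul_one]
    congr 1; ring
  have FE : ∀ i : ℤ, F * E ^ i = E ^ (-i) * F := by
    intro i
    have : SemiconjBy F E E⁻¹ := F_E hE hF
    have := this.zpow_right i
    rw [_root_.inv_zpow'] at this
    exact this
  have FE' : ∀ i : ℤ, F⁻¹ * E ^ i = E ^ (-i) * F⁻¹ := by
    intro i
    rw [inv_mul_eq_iff_eq_mul, ← mul_assoc, FE, neg_neg, mul_assoc, mul_inv_cancel, mul_one]
  have d_zero : d 0 0 = 1 := by simp [hd, dg_one]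
  have L_eq : L = d 0 1 := by simp [hd, hL]
  have Li_eq : L⁻¹ = d 0 (-1) := by simp [hd, hL, dg_inv]
  -- normal form
  have nf : ∀ g ∈ Subgroup.closure ({E, L, F} : Set (GL (Fin 3) ℂ)),
      ∃ a b i k : ℤ, g = d a b * E ^ i * F ^ k := by
    intro g hg
    induction hg using Subgroup.closure_induction_left with
    | one => exact ⟨0, 0, 0, 0, by simp [d_zero]⟩
    | mul_left x hx y hy ih =>
      obtain ⟨a, b, i, k, rfl⟩ := ih
      rcases hx with rfl | rfl | rfl
      · refine ⟨b, -a - b, 1 + i, k, ?_⟩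
        rw [← mul_assoc, ← mul_assoc, d_E, _root_.zpow_one_add]; simp only [mul_assoc]
      · refine ⟨0 + a, 1 + b, i, k, ?_⟩
        rw [L_eq, ← mul_assoc, ← mul_assoc, d_mul]
      · refine ⟨-a - b, b, -i, 1 + k, ?_⟩
        rw [← mul_assoc, ← mul_assoc, d_F, mul_assoc (d _ _), FE, _root_.zpow_one_add]
        simp only [mul_assoc]
    | inv_mul_cancel x hx y hy ih =>
      obtain ⟨a, b, i, k, rfl⟩ := ih
      rcases hx with rfl | rfl | rfl
      · refine ⟨-a - b, a, -1 + i, k, ?_⟩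
        rw [← mul_assoc, ← mul_assoc, d_E', _root_.zpow_add, _root_.zpow_neg_one]; simp only [mul_assoc]
      · refine ⟨0 + a, -1 + b, i, k, ?_⟩
        rw [Li_eq, ← mul_assoc, ← mul_assoc, d_mul]
      · refine ⟨-a - b, b, -i, -1 + k, ?_⟩
        rw [← mul_assoc, ← mul_assoc, d_F', mul_assoc (d _ _), FE', _root_.zpow_add, _root_.zpow_neg_one]
        simp only [mul_assoc]
  -- all normal forms lie in the group
  have mem : ∀ a b i k : ℤ, d a b * E ^ i * F ^ k ∈
      Subgroup.closure ({E, L, F} : Set (GL (Fin 3) ℂ)) := by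
    intro a b i k
    have mE : E ∈ Subgroup.closure ({E, L, F} : Set (GL (Fin 3) ℂ)) :=
      Subgroup.subset_closure (by simp)
    have mL : L ∈ Subgroup.closure ({E, L, F} : Set (GL (Fin 3) ℂ)) :=
      Subgroup.subset_closure (by simp)
    have mF : F ∈ Subgroup.closure ({E, L, F} : Set (GL (Fin 3) ℂ)) :=
      Subgroup.subset_closure (by simp)
    refine mul_mem (mul_mem ?_ (zpow_mem mE _)) (zpow_mem mF _)
    have h1 : E * L * E⁻¹ = d 1 (-1) := by
      rw [L_eq, d_E, mul_inv_cancel_right]; simp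
    have h2 : d a b = (E * L * E⁻¹) ^ a * L ^ (a + b) := by
      rw [h1, L_eq]
      simp only [hd, dg_zpow, dg_mul, ← _root_.zpow_mul, ← _root_.zpow_add]
      congr 2 <;> ring
    rw [h2]
    exact mul_mem (zpow_mem (mul_mem (mul_mem mE mL) (inv_mem mE)) _) (zpow_mem mL _)
  have d_mod : ∀ a b : ℤ, d a b = d (a % n) (b % n) := by
    have : ∀ a : ℤ, ν ^ a = ν ^ (a % n) := by
      intro a
      conv_lhs => rw [← Int.emod_add_mul_ediv a n, _root_.zpow_add, _root_.zpow_mul]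
      simp [hν.pow_eq_one]
    intro a b
    simp only [hd]
    rw [this a, this b]
  obtain ⟨M', hM'⟩ := hM
  have FM : F ^ (M : ℤ) = sc (ξ ^ M) := by
    have h1 : (M : ℤ) = 2 * M' := by omega
    rw [h1, F_even hF, ← h1]; norm_cast
  have FMd : ∀ t : ℤ, F ^ ((M : ℤ) * t) = d (q * t) (q * t) := by
    intro t
    rw [_root_.zpow_mul, FM, hνξ, sc_eq_dg, dg_zpow]
    · simp only [hd]; congr 1 <;> rw [_root_.zpow_mul] <;> norm_cast
    · rw [← pow_mul, mul_comm, ← hn, hν.pow_eq_one]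
  have FMc : ∀ (t : ℤ) (g : GL (Fin 3) ℂ), F ^ ((M : ℤ) * t) * g = g * F ^ ((M : ℤ) * t) := by
    intro t g
    rw [_root_.zpow_mul, FM, sc_zpow, sc_comm]
  let f : Fin n × Fin n × Fin 3 × Fin M → GL (Fin 3) ℂ := fun p =>
    d (p.1 : ℕ) (p.2.1 : ℕ) * E ^ (((p.2.2.1 : ℕ) : ℤ)) * F ^ (((p.2.2.2 : ℕ) : ℤ))
  have hn0 : 0 < n := by omega
  have hrange : ((Subgroup.closure ({E, L, F} : Set (GL (Fin 3) ℂ)) :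
      Subgroup (GL (Fin 3) ℂ)) : Set (GL (Fin 3) ℂ)) = Set.range f := by
    ext g
    constructor
    · intro hg
      obtain ⟨a, b, i, k, rfl⟩ := nf g hg
      have fin : ∀ (N : ℕ) (z : ℤ), 0 < N → ∃ r : Fin N, ((r : ℕ) : ℤ) = z % N := by
        intro N z hN
        have h1 := Int.emod_nonneg z (b := (N : ℤ)) (by omega)
        have h2 := Int.emod_lt_of_pos z (b := (N : ℤ)) (by omega)
        exact ⟨⟨(z % N).toNat, by omega⟩, by simp only; omega⟩
      obtain ⟨k', hk'⟩ := fin M k hM0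
      obtain ⟨i', hi'⟩ := fin 3 i (by norm_num)
      obtain ⟨a', ha'⟩ := fin n (a + q * (k / M)) hn0
      obtain ⟨b', hb'⟩ := fin n (b + q * (k / M)) hn0
      refine ⟨(a', b', i', k'), ?_⟩
      simp only [f]
      rw [ha', hb', ← d_mod, hi', hk', ← d_mul, ← FMd]
      have : ((3 : ℕ) : ℤ) = 3 := rfl
      rw [this, ← E_mod hE, mul_assoc (d a b), FMc, mul_assoc, mul_assoc, ← _root_.zpow_add,
        mul_assoc, add_comm, Int.emod_add_mul_ediv]
    · rintro ⟨p, rfl⟩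
      exact mem _ _ _ _
  have hinj : Function.Injective f := by
    rintro ⟨a, b, i, k⟩ ⟨a', b', i', k'⟩ h
    simp only [f] at h
    have h1 : d ((a : ℕ) - (a' : ℕ)) ((b : ℕ) - (b' : ℕ)) * E ^ ((i : ℕ) : ℤ) *
        F ^ (((k : ℕ) : ℤ) - (k' : ℕ)) = E ^ ((i' : ℕ) : ℤ) := by
      have e1 : d ((a : ℕ) - (a' : ℕ)) ((b : ℕ) - (b' : ℕ)) =
          d (-(a' : ℕ)) (-(b' : ℕ)) * d (a : ℕ) (b : ℕ) := by
        rw [d_mul]; congr 1 <;> ring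
      rw [e1, _root_.zpow_sub, ← mul_assoc, mul_inv_eq_iff_eq_mul]
      simp only [mul_assoc] at h ⊢
      rw [h, ← mul_assoc, d_mul]
      simp [d_zero]
    have hdvd : ∀ z : ℤ, ξ ^ z = 1 → ((3 * M : ℕ) : ℤ) ∣ z :=
      fun z hz => (hξ.zpow_eq_one_iff_dvd z).1 hz
    obtain ⟨t, ht⟩ := Int.even_or_odd' (((k : ℕ) : ℤ) - (k' : ℕ))
    rcases ht with ht | ht
    · rw [ht, F_even hF] at h1
      have h2 : d ((a : ℕ) - (a' : ℕ)) ((b : ℕ) - (b' : ℕ)) * E ^ (((i : ℕ) : ℤ) - (i' : ℕ)) *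
          sc (ξ ^ (2 * t)) = 1 := by
        rw [_root_.zpow_sub, ← mul_assoc, mul_assoc _ _ (sc _), ← sc_comm, ← mul_assoc, h1,
          mul_inv_cancel]
      obtain ⟨c1, c2, c3, c4⟩ := key_even hE _ _ _ _ h2
      have hi : i = i' := by
        apply Fin.ext
        have := i.2
        have := i'.2
        omega
      have hk : k = k' := by
        rw [← zpow_natCast, ← _root_.zpow_mul, ← ht] at c4
        obtain ⟨s, hs⟩ := hdvd _ c4
        push_cast at hs
        have hs' : ((k : ℕ) : ℤ) - (k' : ℕ) = M * s := by linarith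
        apply Fin.ext
        have b1 := k.2
        have b2 := k'.2
        have : (M : ℤ) ∣ ((k : ℕ) : ℤ) - (k' : ℕ) := ⟨s, hs'⟩
        have := Int.eq_zero_of_abs_lt_dvd this (by rw [abs_lt]; constructor <;> omega)
        omega
      have ht0 : ξ ^ (2 * t) = 1 := by rw [← ht, hk]; simp
      rw [ht0, mul_one] at c2 c3
      have hmod : ∀ u v : Fin n, ν ^ (((u : ℕ) : ℤ) - (v : ℕ)) = 1 → u = v := by
        intro u v huv
        have := (hν.zpow_eq_one_iff_dvd _).1 huv
        have b1 := u.2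
        have b2 := v.2
        have := Int.eq_zero_of_abs_lt_dvd this (by rw [abs_lt]; constructor <;> omega)
        apply Fin.ext
        omega
      rw [hmod a a' c2, hmod b b' c3, hi, hk]
    · exfalso
      rw [ht, _root_.zpow_add, F_even hF, zpow_one] at h1
      refine key_odd hE hF _ _ (ξ ^ (2 * t)) (((i : ℕ) : ℤ) + (i' : ℕ)) (?_ :
        d ((a : ℕ) - (a' : ℕ)) ((b : ℕ) - (b' : ℕ)) * _ * _ = 1)
      have h3 := FE (-(i' : ℕ))
      rw [neg_neg] at h3
      rw [_root_.zpow_add, sc_comm, ← mul_assoc, mul_assoc (d _ _), mul_assoc (E ^ _), ← h3]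
      rw [sc_comm] at h1
      have h4 : sc (ξ ^ (2 * t)) * E ^ (-((i' : ℕ) : ℤ)) = E ^ (-((i' : ℕ) : ℤ)) * sc (ξ ^ (2 * t)) :=
        sc_comm _ _
      simp only [mul_assoc] at h1 ⊢
      rw [← h4]
      calc _ = (d ((a : ℕ) - (a' : ℕ)) ((b : ℕ) - (b' : ℕ)) * (E ^ ((i : ℕ) : ℤ) *
            (F * sc (ξ ^ (2 * t))))) * E ^ (-((i' : ℕ) : ℤ)) := by simp only [mul_assoc]
        _ = 1 := by rw [h1, ← _root_.zpow_add]; simp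
  have : Nat.card ↥(Subgroup.closure ({E, L, F} : Set (GL (Fin 3) ℂ))) =
      Nat.card (Set.range f) := by
    rw [← hrange]; rfl
  rw [this, Nat.card_range_of_injective hinj]
  simp

end DeltaPrime

/-- The group `Δ′(6n², m, j)`, generated by `E`, `L_n` and `−F_{m,j}` inside `GL(3,ℂ)`,
has order `3^m·2^j·n²`. -/
theorem delta_prime_6n2mj_order (n : ℕ) (hn : 0 < n) (hn3 : 3 ∣ n)
    (m : ℕ) (hm : 2 ≤ m) (j : ℕ) (hj : 0 < j)
    (E L F : GL (Fin 3) ℂ)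
    (hE : E.val = Ematrix) (hL : L.val = Lmatrix n) (hF : F.val = -(Fmatrix m j)) :
    Nat.card ↥(Subgroup.closure ({E, L, F} : Set (GL (Fin 3) ℂ)))
      = 3 ^ m * 2 ^ j * n ^ 2 := by
  obtain ⟨q, hq⟩ := hn3
  obtain ⟨m, rfl⟩ : ∃ m', m = m' + 1 := ⟨m - 1, by omega⟩
  obtain ⟨j, rfl⟩ : ∃ j', j = j' + 1 := ⟨j - 1, by omega⟩
  have hq0 : 0 < q := by omega
  set M : ℕ := 3 ^ m * 2 ^ (j + 1) with hMdef
  have hM0 : 0 < M := by positivity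
  have hN : 3 ^ (m + 1) * 2 ^ (j + 1) = 3 * M := by rw [hMdef]; ring
  have hν := Complex.isPrimitiveRoot_exp n hn.ne'
  have hξ := Complex.isPrimitiveRoot_exp (3 * M) (by positivity)
  have hcast : ((3 : ℂ) ^ (m + 1) * (2 : ℂ) ^ (j + 1)) = ((3 * M : ℕ) : ℂ) := by
    rw [← hN]; push_cast; ring
  let ν : ℂˣ := Units.mk0 _ (Complex.exp_ne_zero (2 * (Real.pi : ℂ) * Complex.I / (n : ℂ)))
  let ξ : ℂˣ := Units.mk0 _
    (Complex.exp_ne_zero (2 * (Real.pi : ℂ) * Complex.I / ((3 * M : ℕ) : ℂ)))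
  have hq' : (q : ℂ) ≠ 0 := by exact_mod_cast hq0.ne'
  have hM' : (M : ℂ) ≠ 0 := by exact_mod_cast hM0.ne'
  have hmain := DeltaPrime.main (E := E) (L := L) (F := F) (ξ := ξ) (ν := ν) (n := n) (M := M)
    (q := q) hq hq0 hM0 ?_ ?_ ?_ ?_ hE ?_ ?_
  · rw [hmain, hN]; ring
  · exact ⟨3 ^ m * 2 ^ j, by rw [hMdef]; ring⟩
  · exact IsPrimitiveRoot.coe_units_iff.1 hν
  · exact IsPrimitiveRoot.coe_units_iff.1 hξ
  · apply Units.ext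
    simp only [ν, ξ, Units.val_pow_eq_pow_val, Units.val_mk0, ← Complex.exp_nat_mul]
    congr 1
    rw [hq]; push_cast; field_simp
  · apply Units.ext
    rw [hL]
    simp [Lmatrix, DeltaPrime.dg, ν]
  · rw [hF, Fmatrix, hcast]
    simp [ξ]
end

section
/- Let r be a positive integer all of whose prime factors p satisfy p ≡ 1 (mod 6), let k be an integer with r dividing 1 + k + k², let n be a positive integer not divisible by 3 and coprime to r, and let m ≥ 2 be an integer. Then the subgroup of GL(3,ℂ) generated by B_{r,k}, L_n and E_m (this is the group L_r^{(k)}(n, m)) has order 3^m·r·n². -/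
open Matrix

/-- The matrix `E_m`, with entries `μ = exp(2πi/3^m)` in positions `(0,1)`, `(1,2)`, `(2,0)`
and `0` elsewhere. -/
noncomputable def EMmatrix (m : ℕ) : Matrix (Fin 3) (Fin 3) ℂ :=
  Complex.exp (2 * (Real.pi : ℂ) * Complex.I / ((3 : ℂ) ^ m)) •
    (!![0, 1, 0; 0, 0, 1; 1, 0, 0] : Matrix (Fin 3) (Fin 3) ℂ)

/-- The normal form of an element of the group. -/
def nf {G : Type*} [Group G] (B L M E : G) (b c d j : ℤ) : G :=
  B ^ b * L ^ c * M ^ d * E ^ j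

theorem abstract_card {G : Type*} [Group G] (B L M E : G) (k : ℤ) (r n N : ℕ)
    (hr : 0 < r) (hn : 0 < n) (hN : 0 < N)
    (hnr : Nat.Coprime n r) (hNr : Nat.Coprime N r) (hNn : Nat.Coprime N n)
    (hBL : Commute B L) (hBM : Commute B M) (hLM : Commute L M)
    (hEB : E * B * E⁻¹ = B ^ k) (hEL : E * L * E⁻¹ = M) (hEM : E * M * E⁻¹ = (L * M)⁻¹)
    (hB : orderOf B = r) (hE : orderOf E = N) (hL : L ^ n = 1) (hM : M ^ n = 1)
    (hind : ∀ c d : ℤ, L ^ c * M ^ d = 1 → (n : ℤ) ∣ c ∧ (n : ℤ) ∣ d) :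
    Nat.card ↥(Subgroup.closure ({B, L, E} : Set G)) = N * r * n ^ 2 := by
  have hBr : B ^ r = 1 := hB ▸ pow_orderOf_eq_one B
  have hEN : E ^ N = 1 := hE ▸ pow_orderOf_eq_one E
  have zr : ∀ {x : G} {t : ℕ}, x ^ t = 1 → ∀ a : ℤ, x ^ (a % (t : ℤ)) = x ^ a := by
    intro x t h a
    conv_rhs => rw [← Int.emod_add_mul_ediv a t, _root_.zpow_add, _root_.zpow_mul, _root_.zpow_natCast, h, _root_.one_zpow,
      mul_one]
  have mulB : ∀ a b c d j : ℤ, B ^ a * nf B L M E b c d j = nf B L M E (a + b) c d j := by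
    intro a b c d j; simp only [nf, _root_.zpow_add, mul_assoc]
  have mulL : ∀ a b c d j : ℤ, L ^ a * nf B L M E b c d j = nf B L M E b (a + c) d j := by
    intro a b c d j
    simp only [nf, _root_.zpow_add]
    have := ((hBL.zpow_zpow b a).eq)
    simp only [← mul_assoc]
    rw [← this]
  have mulE : ∀ b c d j : ℤ, E * nf B L M E b c d j = nf B L M E (k * b) (-d) (c - d) (j + 1) := by
    intro b c d j
    have e1 : E * B ^ b * E⁻¹ = B ^ (k * b) := by rw [← conj_zpow, hEB, _root_.zpow_mul]
    have e2 : E * L ^ c * E⁻¹ = M ^ c := by rw [← conj_zpow, hEL]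
    have e3 : E * M ^ d * E⁻¹ = L ^ (-d) * M ^ (-d) := by
      rw [← conj_zpow, hEM, _root_.inv_zpow, ← _root_.zpow_neg, hLM.mul_zpow]
    have : E * nf B L M E b c d j
        = (E * B ^ b * E⁻¹) * (E * L ^ c * E⁻¹) * (E * M ^ d * E⁻¹) * (E ^ (1 + j)) := by
      rw [_root_.zpow_add, _root_.zpow_one]; simp only [nf]; group
    rw [this, e1, e2, e3, add_comm 1 j]
    simp only [nf]
    congr 1
    rw [mul_assoc, ← mul_assoc (M ^ c), ← (hLM.zpow_zpow (-d) c).eq, mul_assoc (L ^ (-d)),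
      ← _root_.zpow_add, sub_eq_add_neg, mul_assoc]
  have hmemM : M ∈ Subgroup.closure ({B, L, E} : Set G) := by
    rw [← hEL]
    have h1 : E ∈ Subgroup.closure ({B, L, E} : Set G) := Subgroup.subset_closure (by simp)
    have h2 : L ∈ Subgroup.closure ({B, L, E} : Set G) := Subgroup.subset_closure (by simp)
    exact mul_mem (mul_mem h1 h2) (inv_mem h1)
  have hmem : ∀ b c d j : ℤ, nf B L M E b c d j ∈ Subgroup.closure ({B, L, E} : Set G) := by
    intro b c d j
    have h1 : E ∈ Subgroup.closure ({B, L, E} : Set G) := Subgroup.subset_closure (by simp)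
    have h2 : L ∈ Subgroup.closure ({B, L, E} : Set G) := Subgroup.subset_closure (by simp)
    have h3 : B ∈ Subgroup.closure ({B, L, E} : Set G) := Subgroup.subset_closure (by simp)
    exact mul_mem (mul_mem (mul_mem (zpow_mem h3 _) (zpow_mem h2 _)) (zpow_mem hmemM _))
      (zpow_mem h1 _)
  have mulEpow : ∀ (t : ℕ) (b c d j : ℤ), ∃ b' c' d' j' : ℤ,
      E ^ t * nf B L M E b c d j = nf B L M E b' c' d' j' := by
    intro t
    induction t with
    | zero => intro b c d j; exact ⟨b, c, d, j, by simp⟩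
    | succ t ih =>
      intro b c d j
      rw [pow_succ, mul_assoc, mulE]
      exact ih _ _ _ _
  have hEinv : E⁻¹ = E ^ (N - 1) := by
    rw [inv_eq_iff_mul_eq_one, ← pow_succ', Nat.sub_add_cancel hN, hEN]
  have hsurj : ∀ x ∈ Subgroup.closure ({B, L, E} : Set G), ∃ b c d j : ℤ,
      x = nf B L M E b c d j := by
    intro x hx
    induction hx using Subgroup.closure_induction_left with
    | one => exact ⟨0, 0, 0, 0, by simp [nf]⟩
    | mul_left x hx y hy ih =>
      obtain ⟨b, c, d, j, rfl⟩ := ih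
      rcases hx with rfl | rfl | rfl
      · exact ⟨_, _, _, _, by rw [← mulB 1, _root_.zpow_one]⟩
      · exact ⟨_, _, _, _, by rw [← mulL 1, _root_.zpow_one]⟩
      · exact ⟨_, _, _, _, mulE _ _ _ _⟩
    | inv_mul_cancel x hx y hy ih =>
      obtain ⟨b, c, d, j, rfl⟩ := ih
      rcases hx with rfl | rfl | rfl
      · exact ⟨_, _, _, _, by rw [← mulB (-1), _root_.zpow_neg_one]⟩
      · exact ⟨_, _, _, _, by rw [← mulL (-1), _root_.zpow_neg_one]⟩
      · rw [hEinv]; exact mulEpow _ _ _ _ _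
  have cop : ∀ {a b : ℕ} {z : ℤ}, Nat.Coprime a b → (a : ℤ) ∣ z * b → (a : ℤ) ∣ z := by
    intro a b z h h'
    exact IsCoprime.dvd_of_dvd_mul_right (Nat.isCoprime_iff_coprime.mpr h) h'
  have nfone : ∀ b c d j : ℤ, nf B L M E b c d j = 1 →
      (r : ℤ) ∣ b ∧ (n : ℤ) ∣ c ∧ (n : ℤ) ∣ d ∧ (N : ℤ) ∣ j := by
    intro b c d j h
    have hc1 : Commute (B ^ b) (L ^ c * M ^ d) :=
      (hBL.zpow_zpow b c).mul_right (hBM.zpow_zpow b d)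
    have hLMn : (L ^ c * M ^ d) ^ n = 1 := by
      rw [(hLM.zpow_zpow c d).mul_pow, ← _root_.zpow_natCast, ← _root_.zpow_natCast, ← _root_.zpow_mul, ← _root_.zpow_mul,
        mul_comm c, mul_comm d, _root_.zpow_mul, _root_.zpow_mul, _root_.zpow_natCast, _root_.zpow_natCast, hL, hM]; simp
    have hBbr : (B ^ b) ^ r = 1 := by
      rw [← _root_.zpow_natCast, ← _root_.zpow_mul, mul_comm, _root_.zpow_mul, _root_.zpow_natCast, hBr, _root_.one_zpow]
    have hj : (N : ℤ) ∣ j := by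
      have h1 : E ^ j = (B ^ b * (L ^ c * M ^ d))⁻¹ := by
        rw [eq_comm, inv_eq_iff_mul_eq_one, ← mul_assoc]; exact h
      have h2 : E ^ (j * (r * n : ℕ)) = 1 := by
        rw [_root_.zpow_mul, _root_.zpow_natCast, h1, _root_.inv_pow, hc1.mul_pow, pow_mul, hBbr, mul_comm r n, pow_mul,
          hLMn]; simp
      have h3 := orderOf_dvd_iff_zpow_eq_one.mpr h2
      rw [hE] at h3
      exact cop (Nat.Coprime.mul_right hNr hNn) h3
    have hEj : E ^ j = 1 := by
      obtain ⟨t, rfl⟩ := hj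
      rw [_root_.zpow_mul, _root_.zpow_natCast, hEN, _root_.one_zpow]
    have h' : B ^ b * (L ^ c * M ^ d) = 1 := by
      rw [← mul_assoc]; simpa [nf, hEj] using h
    have hb : (r : ℤ) ∣ b := by
      have h2 : B ^ (b * n) = 1 := by
        have := congrArg (· ^ n) h'
        simp only [hc1.mul_pow, hLMn, one_pow, mul_one] at this
        rw [_root_.zpow_mul, _root_.zpow_natCast, this]
      have h3 := orderOf_dvd_iff_zpow_eq_one.mpr h2
      rw [hB] at h3
      exact cop hnr.symm h3
    have hBb : B ^ b = 1 := by
      obtain ⟨t, rfl⟩ := hb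
      rw [_root_.zpow_mul, _root_.zpow_natCast, hBr, _root_.one_zpow]
    rw [hBb, one_mul] at h'
    exact ⟨hb, (hind c d h').1, (hind c d h').2, hj⟩
  have nfeq : ∀ b c d j b' c' d' j' : ℤ, nf B L M E b c d j = nf B L M E b' c' d' j' →
      nf B L M E (b - b') (c - c') (d - d') (j - j') = 1 := by
    intro b c d j b' c' d' j' h
    have h1 : M ^ (-d') * (L ^ (-c') * (B ^ (-b') * nf B L M E b c d j)) = E ^ j' := by
      rw [h]; simp only [nf]; group
    rw [mulB, mulL] at h1
    have h2 : M ^ (-d') * nf B L M E (-b' + b) (-c' + c) d j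
        = nf B L M E (-b' + b) (-c' + c) (-d' + d) j := by
      have hc : Commute (M ^ (-d')) (B ^ (-b' + b) * L ^ (-c' + c)) :=
        ((hBM.zpow_zpow _ _).symm).mul_right ((hLM.zpow_zpow _ _).symm)
      simp only [nf]
      rw [← mul_assoc, ← mul_assoc, hc.eq, mul_assoc (_ * _) (M ^ (-d')), ← _root_.zpow_add]
    rw [h2] at h1
    have h3 : nf B L M E (b - b') (c - c') (d - d') (j - j')
        = nf B L M E (-b' + b) (-c' + c) (-d' + d) j * E ^ (-j') := by
      simp only [nf, mul_assoc, ← _root_.zpow_add]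
      simp only [sub_eq_neg_add, add_comm]
    rw [h3, h1, ← _root_.zpow_add]; simp
  let f : Fin N × Fin r × Fin n × Fin n → ↥(Subgroup.closure ({B, L, E} : Set G)) :=
    fun p => ⟨nf B L M E (p.2.1 : ℕ) (p.2.2.1 : ℕ) (p.2.2.2 : ℕ) (p.1 : ℕ), hmem _ _ _ _⟩
  have finj : ∀ {t : ℕ} (a b : Fin t), (t : ℤ) ∣ ((a : ℕ) : ℤ) - ((b : ℕ) : ℤ) → a = b := by
    intro t a b h
    have ha := a.2
    have hb := b.2
    apply Fin.ext
    have := Int.eq_zero_of_abs_lt_dvd h (by rw [abs_lt]; constructor <;> omega)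
    omega
  have fbij : Function.Bijective f := by
    constructor
    · rintro ⟨j, b, c, d⟩ ⟨j', b', c', d'⟩ h
      have h := nfone _ _ _ _ (nfeq _ _ _ _ _ _ _ _ (congrArg Subtype.val h))
      obtain ⟨h1, h2, h3, h4⟩ := h
      have e1 : b = b' := finj _ _ h1
      have e2 : c = c' := finj _ _ h2
      have e3 : d = d' := finj _ _ h3
      have e4 : j = j' := finj _ _ h4
      rw [e1, e2, e3, e4]
    · rintro ⟨x, hx⟩
      obtain ⟨b, c, d, j, rfl⟩ := hsurj x hx
      have key : ∀ (t : ℕ), 0 < t → ∀ a : ℤ, ∃ i : Fin t, ((i : ℕ) : ℤ) = a % (t : ℤ) := by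
        intro t ht a
        have h1 := Int.emod_nonneg a (b := (t : ℤ)) (by omega)
        have h2 := Int.emod_lt_of_pos a (b := (t : ℤ)) (by omega)
        exact ⟨⟨(a % (t : ℤ)).toNat, by omega⟩, by simp [h1]⟩
      obtain ⟨j', hj'⟩ := key N hN j
      obtain ⟨b', hb'⟩ := key r hr b
      obtain ⟨c', hc'⟩ := key n hn c
      obtain ⟨d', hd'⟩ := key n hn d
      refine ⟨⟨j', b', c', d'⟩, Subtype.ext ?_⟩
      simp only [f, nf, hj', hb', hc', hd', zr hBr, zr hEN, zr hL, zr hM]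
  rw [← Nat.card_eq_of_bijective f fbij]
  simp
  ring

/-- The diagonal embedding of the torus into `GL(3,ℂ)`. -/
noncomputable def dg : (Fin 3 → ℂˣ) →* GL (Fin 3) ℂ where
  toFun u := ⟨Matrix.diagonal fun i => (u i : ℂ), Matrix.diagonal fun i => ((u i)⁻¹ : ℂˣ),
    by simp, by simp⟩
  map_one' := by ext : 1; simp
  map_mul' u v := by ext : 1; simp

theorem dg_val (u : Fin 3 → ℂˣ) : (dg u).val = Matrix.diagonal fun i => (u i : ℂ) := rfl

theorem dg_inj : Function.Injective dg := by
  intro u v h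
  have := congrArg Units.val h
  rw [dg_val, dg_val] at this
  have := Matrix.diagonal_injective this
  funext i
  exact Units.ext (congrFun this i)

theorem conj_dg (m : ℕ) (E : GL (Fin 3) ℂ) (hE : E.val = EMmatrix m) (u : Fin 3 → ℂˣ) :
    E * dg u * E⁻¹ = dg ![u 1, u 2, u 0] := by
  rw [mul_inv_eq_iff_eq_mul]
  apply Units.ext
  rw [Units.val_mul, Units.val_mul, dg_val, dg_val, hE, EMmatrix]
  ext i j
  fin_cases i <;> fin_cases j <;> simp [Matrix.mul_apply, Fin.sum_univ_three, mul_comm]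

theorem E_cube (m : ℕ) (E : GL (Fin 3) ℂ) (hE : E.val = EMmatrix m) (w : ℂˣ)
    (hw : (w : ℂ) = Complex.exp (2 * (Real.pi : ℂ) * Complex.I / ((3 : ℂ) ^ m))) :
    E ^ 3 = dg (fun _ => w ^ 3) := by
  apply Units.ext
  rw [Units.val_pow_eq_pow_val, dg_val, hE, EMmatrix, ← hw]
  ext i j
  fin_cases i <;> fin_cases j <;>
    simp [pow_succ, Matrix.mul_apply, Fin.sum_univ_three]

theorem exists_root (n : ℕ) (hn : 0 < n) : ∃ w : ℂˣ,
    (w : ℂ) = Complex.exp (2 * (Real.pi : ℂ) * Complex.I / (n : ℂ)) ∧ orderOf w = n := by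
  refine ⟨Units.mk0 _ (Complex.exp_ne_zero _), rfl, ?_⟩
  rw [← orderOf_units]
  exact (Complex.isPrimitiveRoot_exp n hn.ne').eq_orderOf.symm

theorem E_order (m : ℕ) (hm : 2 ≤ m) (E : GL (Fin 3) ℂ) (hE : E.val = EMmatrix m) :
    orderOf E = 3 ^ m := by
  obtain ⟨w, hw, ho⟩ := exists_root (3 ^ m) (by positivity)
  push_cast at hw
  have h3 := E_cube m E hE w hw
  obtain ⟨s, rfl⟩ : ∃ s, m = s + 2 := ⟨m - 2, by omega⟩
  have : Fact (Nat.Prime 3) := ⟨Nat.prime_three⟩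
  apply orderOf_eq_prime_pow (n := s + 1)
  · rw [pow_succ', pow_mul, h3, ← _root_.map_pow, ← _root_.map_one dg]
    intro h
    have h := congrFun (dg_inj h) 0
    simp only [Pi.pow_apply, Pi.one_apply] at h
    rw [← pow_mul] at h
    have := orderOf_dvd_of_pow_eq_one h
    rw [ho, ← pow_succ', Nat.pow_dvd_pow_iff_le_right (by norm_num)] at this
    omega
  · rw [show s + 1 + 1 = (s + 1) + 1 from rfl, pow_succ', pow_mul, h3, ← _root_.map_pow, ← _root_.map_one dg]
    congr 1
    funext i
    simp only [Pi.pow_apply, Pi.one_apply]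
    rw [← pow_mul, ← pow_succ', ← ho, pow_orderOf_eq_one]

/-- The group `L_r^{(k)}(n, m)`, generated by `B_{r,k}`, `L_n` and `E_m` inside `GL(3,ℂ)`,
has order `3^m·r·n²`. -/
theorem L_rk_nm_order (r : ℕ) (hr : 0 < r)
    (hrprime : ∀ p : ℕ, p.Prime → p ∣ r → p % 6 = 1)
    (k : ℤ) (hk : (r : ℤ) ∣ 1 + k + k ^ 2)
    (n : ℕ) (hn : 0 < n) (hn3 : ¬ 3 ∣ n) (hnr : Nat.Coprime n r)
    (m : ℕ) (hm : 2 ≤ m)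
    (B L Em : GL (Fin 3) ℂ)
    (hB : B.val = Bmatrix r k) (hL : L.val = Lmatrix n) (hEm : Em.val = EMmatrix m) :
    Nat.card ↥(Subgroup.closure ({B, L, Em} : Set (GL (Fin 3) ℂ)))
      = 3 ^ m * r * n ^ 2 := by
  obtain ⟨u, hu, huo⟩ := exists_root r hr
  obtain ⟨v, hv, hvo⟩ := exists_root n hn
  have hB' : B = dg ![u, u ^ k, u ^ (-1 - k)] := by
    apply Units.ext
    rw [hB, dg_val, Bmatrix, ← hu]
    congr 1
    funext i
    fin_cases i <;> simp
  have hL' : L = dg ![1, v, v⁻¹] := by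
    apply Units.ext
    rw [hL, dg_val, Lmatrix, ← hv]
    congr 1
    funext i
    fin_cases i <;> simp
  have hvn : v ^ n = 1 := hvo ▸ pow_orderOf_eq_one v
  have hur : u ^ r = 1 := huo ▸ pow_orderOf_eq_one u
  have h3r : Nat.Coprime 3 r := by
    rw [Nat.Prime.coprime_iff_not_dvd Nat.prime_three]
    intro h
    have := hrprime 3 Nat.prime_three h
    omega
  have h3n : Nat.Coprime 3 n := (Nat.Prime.coprime_iff_not_dvd Nat.prime_three).mpr hn3
  have hcomm : ∀ x y : Fin 3 → ℂˣ, Commute (dg x) (dg y) := fun x y => by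
    rw [Commute, SemiconjBy, ← _root_.map_mul, ← _root_.map_mul, mul_comm]
  have huz : ∀ a b : ℤ, (r : ℤ) ∣ a - b → u ^ a = u ^ b := by
    intro a b h
    rw [← huo] at h
    have := orderOf_dvd_iff_zpow_eq_one.mp h
    rwa [_root_.zpow_sub, mul_inv_eq_one] at this
  rw [hB', hL']
  refine abstract_card _ _ (dg ![v, v⁻¹, 1]) Em k r n (3 ^ m) hr hn (by positivity) hnr
    (h3r.pow_left m) (h3n.pow_left m) (hcomm _ _) (hcomm _ _) (hcomm _ _) ?_ ?_ ?_ ?_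
    (E_order m hm Em hEm) ?_ ?_ ?_
  · rw [conj_dg m Em hEm, ← _root_.map_zpow]
    congr 1
    funext i
    fin_cases i
    · simp
    · simp only [Pi.pow_apply]
      simp [← _root_.zpow_mul]
      apply huz
      rw [show -1 - k - k * k = -(1 + k + k ^ 2) by ring]
      exact (Int.dvd_neg).mpr hk
    · simp only [Pi.pow_apply]
      simp [← _root_.zpow_mul]
      rw [← _root_.zpow_one u, ← _root_.zpow_mul]
      apply huz
      convert hk using 1
      ring
  · rw [conj_dg m Em hEm]; rfl
  · rw [conj_dg m Em hEm, ← _root_.map_mul, ← _root_.map_inv]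
    congr 1
    funext i
    fin_cases i <;> simp
  · rw [orderOf_injective dg dg_inj]
    apply Nat.dvd_antisymm
    · apply orderOf_dvd_of_pow_eq_one
      funext i
      have hz : ∀ a : ℤ, (u ^ a) ^ r = 1 := fun a => by
        rw [← _root_.zpow_natCast, ← _root_.zpow_mul, mul_comm, _root_.zpow_mul, _root_.zpow_natCast, hur, _root_.one_zpow]
      fin_cases i
      · simpa using hur
      · simpa using hz k
      · simpa using hz (-1 - k)
    · rw [← huo]
      apply orderOf_dvd_of_pow_eq_one
      exact congrFun (pow_orderOf_eq_one (![u, u ^ k, u ^ (-1 - k)] : Fin 3 → ℂˣ)) 0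
  · rw [← _root_.map_pow, ← _root_.map_one dg]
    congr 1
    funext i
    fin_cases i <;> simp [hvn]
  · rw [← _root_.map_pow, ← _root_.map_one dg]
    congr 1
    funext i
    fin_cases i <;> simp [hvn]
  · intro c d h
    rw [← _root_.map_zpow, ← _root_.map_zpow, ← _root_.map_mul, ← _root_.map_one dg] at h
    have h := dg_inj h
    have h0 := congrFun h 0
    have h2 := congrFun h 2
    simp at h0 h2
    rw [← hvo]
    exact ⟨orderOf_dvd_iff_zpow_eq_one.mpr h2, orderOf_dvd_iff_zpow_eq_one.mpr h0⟩
end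

section
/- Let m be a positive integer and let j ≥ 2 be an integer. Then the subgroup of GL(3,ℂ) generated by E and i·Q_{m,j} (this is the group Ξ(m, j)) has order 3^{m+2}·2^j. -/
open Matrix

/-- The matrix `Q_{m,j} = (−iξ/√3)·[[1, ω², ω²], [ω², ω², 1], [1, ω, 1]]`,
where `ω = exp(2πi/3)` and `ξ = exp(2πi/(3^m·2^j))`. -/
noncomputable def Qmatrix (m j : ℕ) : Matrix (Fin 3) (Fin 3) ℂ :=
  (-Complex.I * Complex.exp (2 * (Real.pi : ℂ) * Complex.I / ((3 : ℂ) ^ m * (2 : ℂ) ^ j)) /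
      (Real.sqrt 3 : ℂ)) •
    (!![1, Complex.exp (2 * (Real.pi : ℂ) * Complex.I / 3) ^ 2,
          Complex.exp (2 * (Real.pi : ℂ) * Complex.I / 3) ^ 2;
        Complex.exp (2 * (Real.pi : ℂ) * Complex.I / 3) ^ 2,
          Complex.exp (2 * (Real.pi : ℂ) * Complex.I / 3) ^ 2, 1;
        1, Complex.exp (2 * (Real.pi : ℂ) * Complex.I / 3), 1] :
      Matrix (Fin 3) (Fin 3) ℂ)

section AbstractPart

lemma pow_mod_natCard_aux {G : Type*} [Group G] {n : ℕ} (g : G) (h : g ^ n = 1) {x : ℕ} :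
    g ^ x = g ^ (x % n) := by
  conv_lhs => rw [← Nat.div_add_mod x n, pow_add, pow_mul, h, one_pow, one_mul]

variable {G : Type*} [Group G]

lemma xi_comm_pow (c Z E : G) (r : ℕ) (hc : ∀ g, c * g = g * c)
    (hEZ : E * Z = c ^ r * Z * E) (x y : ℕ) :
    E ^ x * Z ^ y = c ^ (r * (x * y)) * Z ^ y * E ^ x := by
  have hcp : ∀ n g, c ^ n * g = g * c ^ n := fun n g => (show Commute c g from hc g).pow_left n
  have h1 : ∀ y, E * Z ^ y = c ^ (r * y) * Z ^ y * E := by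
    intro y
    induction y with
    | zero => simp
    | succ y ih =>
      calc E * Z ^ (y + 1) = (E * Z ^ y) * Z := by rw [pow_succ, mul_assoc]
        _ = c ^ (r * y) * Z ^ y * (E * Z) := by rw [ih]; group
        _ = c ^ (r * y) * (Z ^ y * c ^ r) * Z * E := by rw [hEZ]; simp only [mul_assoc]
        _ = c ^ (r * (y + 1)) * Z ^ (y + 1) * E := by
          rw [← hcp, mul_add, mul_one, pow_add, pow_succ]; simp only [mul_assoc]
  induction x with
  | zero => simp
  | succ x ih =>
    calc E ^ (x + 1) * Z ^ y = E * (E ^ x * Z ^ y) := by rw [pow_succ', mul_assoc]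
      _ = (E * c ^ (r * (x * y))) * Z ^ y * E ^ x := by rw [ih]; simp only [mul_assoc]
      _ = c ^ (r * (x * y)) * (E * Z ^ y) * E ^ x := by rw [← hcp]; simp only [mul_assoc]
      _ = c ^ (r * ((x + 1) * y)) * Z ^ y * E ^ (x + 1) := by
        rw [h1, show r * ((x + 1) * y) = r * (x * y) + r * y by ring, pow_add, pow_succ']
        simp only [mul_assoc]

lemma xi_abstract (c Z E Q : G) (r K : ℕ) (hK : 0 < K) (hord : orderOf c = K)
    (hc : ∀ g, c * g = g * c) (hE3 : E ^ 3 = 1) (hZ3 : Z ^ 3 = 1)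
    (hEZ : E * Z = c ^ r * Z * E) (hQZ : Q * Z = c ^ r * Z * E * Q)
    (hQE : Q * E = c ^ (2 * r) * Z * E * E * Q) (hQ4 : Q ^ 4 = c ^ (1 + 2 * r))
    (hind : ∀ n a b e : ℕ, a < 3 → b < 3 → e < 4 → c ^ n * Q ^ e = Z ^ a * E ^ b →
      a = 0 ∧ b = 0 ∧ e = 0) :
    Nat.card ↥(Subgroup.closure ({E, Q} : Set G)) = K * 36 := by
  have hcp : ∀ n g, c ^ n * g = g * c ^ n := fun n g => (show Commute c g from hc g).pow_left n
  have hcK : c ^ K = 1 := by rw [← hord]; exact pow_orderOf_eq_one c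
  have hcK' : ∀ n, c ^ (K * n) = 1 := fun n => by rw [pow_mul, hcK, one_pow]
  have hEx := xi_comm_pow c Z E r hc hEZ
  let f : Fin K × Fin 3 × Fin 3 × Fin 4 → G := fun p =>
    c ^ (p.1 : ℕ) * Z ^ (p.2.1 : ℕ) * E ^ (p.2.2.1 : ℕ) * Q ^ (p.2.2.2 : ℕ)
  -- injectivity
  have key : ∀ k a b d k' a' b' d' : ℕ, k < K → k' < K → a < 3 → a' < 3 → b < 3 → b' < 3 →
      d < 4 → d' ≤ d → c ^ k * Z ^ a * E ^ b * Q ^ d = c ^ k' * Z ^ a' * E ^ b' * Q ^ d' →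
      k = k' ∧ a = a' ∧ b = b' ∧ d = d' := by
    intro k a b d k' a' b' d' hk hk' ha ha' hb hb' hd hdd h
    obtain ⟨e, rfl⟩ := Nat.exists_eq_add_of_le' hdd
    rw [pow_add, ← mul_assoc, mul_left_inj] at h
    have hz : Z ^ (3 - a) * Z ^ a = 1 := by rw [← pow_add, Nat.sub_add_cancel ha.le, hZ3]
    have he : E ^ (3 - b) * E ^ b = 1 := by rw [← pow_add, Nat.sub_add_cancel hb.le, hE3]
    have h2 : c ^ k * Q ^ e =
        c ^ (k' + r * ((3 - b) * (3 - a + a'))) * Z ^ (3 - a + a') * E ^ (3 - b + b') := by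
      calc c ^ k * Q ^ e = c ^ k * (E ^ (3 - b) * (Z ^ (3 - a) * Z ^ a) * E ^ b) * Q ^ e := by
            rw [hz, mul_one, he, mul_one]
        _ = (c ^ k * (E ^ (3 - b) * Z ^ (3 - a))) * (Z ^ a * E ^ b * Q ^ e) := by
            simp only [mul_assoc]
        _ = E ^ (3 - b) * Z ^ (3 - a) * (c ^ k * Z ^ a * E ^ b * Q ^ e) := by
            rw [hcp]; simp only [mul_assoc]
        _ = (E ^ (3 - b) * Z ^ (3 - a) * c ^ k') * Z ^ a' * E ^ b' := by
            rw [h]; simp only [mul_assoc]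
        _ = c ^ k' * (E ^ (3 - b) * Z ^ (3 - a + a')) * E ^ b' := by
            rw [← hcp, pow_add Z]; simp only [mul_assoc]
        _ = _ := by rw [hEx, pow_add c, pow_add E]; simp only [mul_assoc]
    generalize hT : k' + r * ((3 - b) * (3 - a + a')) = T at h2
    have h3 : c ^ (k + (K - 1) * T) * Q ^ e
        = Z ^ ((3 - a + a') % 3) * E ^ ((3 - b + b') % 3) := by
      rw [← pow_mod_natCard_aux Z hZ3, ← pow_mod_natCard_aux E hE3]
      calc c ^ (k + (K - 1) * T) * Q ^ e = c ^ ((K - 1) * T) * (c ^ k * Q ^ e) := by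
            rw [add_comm, pow_add, mul_assoc]
        _ = (c ^ ((K - 1) * T + T)) * Z ^ (3 - a + a') * E ^ (3 - b + b') := by
            rw [h2, pow_add c]; simp only [mul_assoc]
        _ = _ := by
            rw [show (K - 1) * T + T = K * T by
              obtain ⟨L, rfl⟩ := Nat.exists_eq_succ_of_ne_zero hK.ne'
              simp; ring, hcK', one_mul]
    obtain ⟨h4, h5, h6⟩ := hind _ _ _ _ (Nat.mod_lt _ (by norm_num)) (Nat.mod_lt _ (by norm_num))
      (by omega) h3
    have haa : a = a' := by omega
    have hbb : b = b' := by omega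
    subst haa hbb h6
    refine ⟨?_, rfl, rfl, by omega⟩
    simp only [pow_zero, mul_one, mul_left_inj] at h
    exact pow_injOn_Iio_orderOf (by simpa [hord] using hk) (by simpa [hord] using hk') h
  have hf : Function.Injective f := by
    rintro ⟨k, a, b, d⟩ ⟨k', a', b', d'⟩ h
    simp only [f] at h
    rcases le_total (d' : ℕ) (d : ℕ) with hd | hd
    · obtain ⟨h1, h2, h3, h4⟩ := key _ _ _ _ _ _ _ _ k.2 k'.2 a.2 a'.2 b.2 b'.2 d.2 hd h
      simp [Fin.ext_iff, h1, h2, h3, h4]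
    · obtain ⟨h1, h2, h3, h4⟩ := key _ _ _ _ _ _ _ _ k'.2 k.2 a'.2 a.2 b'.2 b.2 d'.2 hd h.symm
      simp [Fin.ext_iff, h1, h2, h3, h4]
  -- the set of normal forms
  let T : Set G := {g | ∃ k a b d : ℕ, g = c ^ k * Z ^ a * E ^ b * Q ^ d}
  have Tc : ∀ n, ∀ g ∈ T, c ^ n * g ∈ T := by
    rintro n _ ⟨k, a, b, d, rfl⟩
    exact ⟨n + k, a, b, d, by rw [pow_add]; simp only [mul_assoc]⟩
  have TZ : ∀ g ∈ T, Z * g ∈ T := by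
    rintro _ ⟨k, a, b, d, rfl⟩
    refine ⟨k, a + 1, b, d, ?_⟩
    rw [pow_succ']; simp only [← mul_assoc]; rw [← hcp]
  have TE : ∀ g ∈ T, E * g ∈ T := by
    rintro _ ⟨k, a, b, d, rfl⟩
    refine ⟨k + r * (1 * a), a, b + 1, d, ?_⟩
    have := hEx 1 a
    rw [pow_one] at this
    calc E * (c ^ k * Z ^ a * E ^ b * Q ^ d) = (E * c ^ k) * Z ^ a * E ^ b * Q ^ d := by
          simp only [mul_assoc]
      _ = c ^ k * (E * Z ^ a) * E ^ b * Q ^ d := by rw [← hcp]; simp only [mul_assoc]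
      _ = _ := by rw [this, pow_add, pow_succ' E]; simp only [mul_assoc]
  have TQ : ∀ g ∈ T, Q * g ∈ T := by
    rintro _ ⟨k, a, b, d, rfl⟩
    have h1 : ∀ b, Q * (E ^ b * Q ^ d) ∈ T := by
      intro b
      induction b with
      | zero => exact ⟨0, 0, 0, d + 1, by simp [pow_succ']⟩
      | succ b ih =>
        have : Q * (E ^ (b + 1) * Q ^ d)
            = c ^ (2 * r) * (Z * (E * (E * (Q * (E ^ b * Q ^ d))))) := by
          rw [pow_succ', mul_assoc, ← mul_assoc, hQE]; simp only [mul_assoc]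
        rw [this]
        exact Tc _ _ (TZ _ (TE _ (TE _ ih)))
    have h2 : ∀ a, Q * (Z ^ a * (E ^ b * Q ^ d)) ∈ T := by
      intro a
      induction a with
      | zero => simpa using h1 b
      | succ a ih =>
        have : Q * (Z ^ (a + 1) * (E ^ b * Q ^ d))
            = c ^ r * (Z * (E * (Q * (Z ^ a * (E ^ b * Q ^ d))))) := by
          rw [pow_succ', mul_assoc, ← mul_assoc, hQZ]; simp only [mul_assoc]
        rw [this]
        exact Tc _ _ (TZ _ (TE _ ih))
    have h3 : Q * (c ^ k * Z ^ a * E ^ b * Q ^ d) = c ^ k * (Q * (Z ^ a * (E ^ b * Q ^ d))) := by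
      simp only [← mul_assoc]; rw [← hcp]
    rw [h3]
    exact Tc _ _ (h2 a)
  have hEinv : E⁻¹ = E * E := by
    rw [inv_eq_iff_mul_eq_one, ← hE3]; simp only [pow_succ, pow_zero, one_mul, mul_assoc]
  have hQinv : Q⁻¹ = c ^ ((K - 1) * (1 + 2 * r)) * (Q * (Q * Q)) := by
    rw [inv_eq_iff_mul_eq_one, ← mul_assoc, ← hcp, mul_assoc,
      show Q * (Q * (Q * Q)) = Q ^ 4 by simp only [pow_succ, pow_zero, one_mul, mul_assoc], hQ4, ← pow_add,
      show (K - 1) * (1 + 2 * r) + (1 + 2 * r) = K * (1 + 2 * r) by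
        obtain ⟨L, rfl⟩ := Nat.exists_eq_succ_of_ne_zero hK.ne'
        simp; ring, hcK']
  have hsub : ∀ g ∈ Subgroup.closure ({E, Q} : Set G), g ∈ T := by
    intro g hg
    induction hg using Subgroup.closure_induction_left with
    | one => exact ⟨0, 0, 0, 0, by simp⟩
    | mul_left x hx y _ ih =>
      rcases hx with rfl | rfl
      · exact TE _ ih
      · exact TQ _ ih
    | inv_mul_cancel x hx y _ ih =>
      rcases hx with rfl | rfl
      · rw [hEinv, mul_assoc]; exact TE _ (TE _ ih)
      · rw [hQinv]; simp only [mul_assoc]; exact Tc _ _ (TQ _ (TQ _ (TQ _ ih)))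
  have hEm : E ∈ Subgroup.closure ({E, Q} : Set G) := Subgroup.subset_closure (by simp)
  have hQm : Q ∈ Subgroup.closure ({E, Q} : Set G) := Subgroup.subset_closure (by simp)
  have hF : Q * E * Q⁻¹ = c ^ (2 * r) * Z * E * E := by rw [hQE]; group
  have hFm : c ^ (2 * r) * Z * E * E ∈ Subgroup.closure ({E, Q} : Set G) := by
    rw [← hF]; exact mul_mem (mul_mem hQm hEm) (inv_mem hQm)
  have hcr : c ^ r ∈ Subgroup.closure ({E, Q} : Set G) := by
    have : c ^ r = E * (c ^ (2 * r) * Z * E * E) * (c ^ (2 * r) * Z * E * E * E)⁻¹ := by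
      rw [eq_mul_inv_iff_mul_eq]
      calc c ^ r * (c ^ (2 * r) * Z * E * E * E) = (c ^ r * c ^ (2 * r)) * Z * E * E * E := by
            simp only [mul_assoc]
        _ = c ^ (2 * r) * (E * Z) * E * E := by rw [hcp, hEZ]; simp only [mul_assoc]
        _ = _ := by rw [← mul_assoc, hcp]; simp only [mul_assoc]
    rw [this]
    exact mul_mem (mul_mem hEm hFm) (inv_mem (mul_mem hFm hEm))
  have hc2r : c ^ (2 * r) ∈ Subgroup.closure ({E, Q} : Set G) := by
    rw [mul_comm, pow_mul]; exact pow_mem hcr 2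
  have hZm : Z ∈ Subgroup.closure ({E, Q} : Set G) := by
    have : Z = (c ^ (2 * r))⁻¹ * (c ^ (2 * r) * Z * E * E) * E⁻¹ * E⁻¹ := by group
    rw [this]
    exact mul_mem (mul_mem (mul_mem (inv_mem hc2r) hFm) (inv_mem hEm)) (inv_mem hEm)
  have hcm : c ∈ Subgroup.closure ({E, Q} : Set G) := by
    have : c = Q ^ 4 * (c ^ (2 * r))⁻¹ := by
      rw [hQ4, pow_add, pow_one, mul_inv_cancel_right]
    rw [this]
    exact mul_mem (pow_mem hQm 4) (inv_mem hc2r)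
  have hrange : ((Subgroup.closure ({E, Q} : Set G) : Subgroup G) : Set G) = Set.range f := by
    apply Set.Subset.antisymm
    · intro g hg
      obtain ⟨k, a, b, d, rfl⟩ := hsub g hg
      refine ⟨(⟨(k + (1 + 2 * r) * (d / 4)) % K, Nat.mod_lt _ hK⟩,
        ⟨a % 3, Nat.mod_lt _ (by norm_num)⟩, ⟨b % 3, Nat.mod_lt _ (by norm_num)⟩,
        ⟨d % 4, Nat.mod_lt _ (by norm_num)⟩), ?_⟩
      simp only [f]
      rw [← pow_mod_natCard_aux c hcK, ← pow_mod_natCard_aux Z hZ3, ← pow_mod_natCard_aux E hE3]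
      conv_rhs => rw [← Nat.div_add_mod d 4, pow_add, pow_mul, hQ4, ← pow_mul]
      rw [pow_add]
      simp only [mul_assoc]
      rw [hcp ((1 + 2 * r) * (d / 4))]
      simp only [mul_assoc]
      rw [hcp ((1 + 2 * r) * (d / 4)) (Q ^ (d % 4))]
    · rintro _ ⟨⟨k, a, b, d⟩, rfl⟩
      exact mul_mem (mul_mem (mul_mem (pow_mem hcm _) (pow_mem hZm _)) (pow_mem hEm _))
        (pow_mem hQm _)
  have : Nat.card ↥(Subgroup.closure ({E, Q} : Set G)) = Nat.card (Set.range f) := by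
    rw [← hrange]; rfl
  rw [this, ← Nat.card_congr (Equiv.ofInjective f hf)]
  simp

end AbstractPart

section MatrixPart

/-- The matrix part `M` of `Q`, for an abstract third root of unity `w`. -/
noncomputable def xiM (w : ℂ) : Matrix (Fin 3) (Fin 3) ℂ := !![1, w ^ 2, w ^ 2; w ^ 2, w ^ 2, 1; 1, w, 1]

/-- The diagonal matrix `diag(1, w, w²)`. -/
noncomputable def xiZ (w : ℂ) : Matrix (Fin 3) (Fin 3) ℂ := !![1, 0, 0; 0, w, 0; 0, 0, w ^ 2]

/-- One third of the square of `M`. -/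
noncomputable def xiM2 (w : ℂ) : Matrix (Fin 3) (Fin 3) ℂ := !![0, 0, w ^ 2; 0, w, 0; 1, 0, 0]

lemma xiM_sq (w : ℂ) (hw : w ^ 2 + w + 1 = 0) : xiM w * xiM w = (3 : ℂ) • xiM2 w := by
  have h3 : w ^ 3 = 1 := by linear_combination (w - 1) * hw
  ext i j
  fin_cases i <;> fin_cases j <;> simp [xiM, xiM2, Matrix.mul_apply, Fin.sum_univ_three] <;>
    grind

lemma xiM2_sq (w : ℂ) : xiM2 w * xiM2 w = (w ^ 2) • (1 : Matrix (Fin 3) (Fin 3) ℂ) := by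
  ext i j
  fin_cases i <;> fin_cases j <;> simp [xiM2, Matrix.mul_apply, Fin.sum_univ_three] <;> ring

lemma xiE_cube : Ematrix ^ 3 = 1 := by
  ext i j
  fin_cases i <;> fin_cases j <;> simp [Ematrix, pow_succ, Matrix.mul_apply, Fin.sum_univ_three]

lemma xiZ_cube (w : ℂ) (hw : w ^ 2 + w + 1 = 0) : xiZ w ^ 3 = 1 := by
  have h3 : w ^ 3 = 1 := by linear_combination (w - 1) * hw
  ext i j
  fin_cases i <;> fin_cases j <;> simp [xiZ, pow_succ, Matrix.mul_apply, Fin.sum_univ_three] <;>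
    grind

lemma xiE_Z (w : ℂ) (hw : w ^ 2 + w + 1 = 0) : Ematrix * xiZ w = w • (xiZ w * Ematrix) := by
  have h3 : w ^ 3 = 1 := by linear_combination (w - 1) * hw
  ext i j
  fin_cases i <;> fin_cases j <;>
    simp [Ematrix, xiZ, Matrix.mul_apply, Fin.sum_univ_three] <;> grind

lemma xiM_Z (w : ℂ) (hw : w ^ 2 + w + 1 = 0) :
    xiM w * xiZ w = w • (xiZ w * Ematrix * xiM w) := by
  have h3 : w ^ 3 = 1 := by linear_combination (w - 1) * hw
  ext i j
  fin_cases i <;> fin_cases j <;>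
    simp [Ematrix, xiZ, xiM, Matrix.mul_apply, Fin.sum_univ_three] <;> grind

lemma xiM_E (w : ℂ) (hw : w ^ 2 + w + 1 = 0) :
    xiM w * Ematrix = w ^ 2 • (xiZ w * Ematrix * Ematrix * xiM w) := by
  have h3 : w ^ 3 = 1 := by linear_combination (w - 1) * hw
  ext i j
  fin_cases i <;> fin_cases j <;>
    simp [Ematrix, xiZ, xiM, Matrix.mul_apply, Fin.sum_univ_three] <;> grind

/-- `Z ^ a * E ^ b` in explicit form. -/
lemma xi_mono (w : ℂ) (a b : ℕ) (hb : b < 3) (i j : Fin 3) :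
    (xiZ w ^ a * Ematrix ^ b) i j = if (j : ℕ) = ((i : ℕ) + b) % 3 then (w ^ (i : ℕ)) ^ a else 0 := by
  have hZ : xiZ w = Matrix.diagonal (fun i : Fin 3 => w ^ (i : ℕ)) := by
    ext i j
    fin_cases i <;> fin_cases j <;> simp [xiZ]
  rw [hZ, Matrix.diagonal_pow, Matrix.diagonal_mul]
  interval_cases b <;> fin_cases i <;> fin_cases j <;>
    simp [Ematrix, pow_succ, Matrix.mul_apply, Fin.sum_univ_three]

lemma xi_indep (w u t : ℂ) (hw : w ^ 2 + w + 1 = 0) (hu : u ≠ 0) (ht : t ≠ 0) (a b e : ℕ)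
    (ha : a < 3) (hb : b < 3) (he : e < 4)
    (h : u • (t • xiM w) ^ e = xiZ w ^ a * Ematrix ^ b) : a = 0 ∧ b = 0 ∧ e = 0 := by
  have h3 : w ^ 3 = 1 := by linear_combination (w - 1) * hw
  have hw0 : w ≠ 0 := by rintro rfl; simp at hw
  have hw1 : w ≠ 1 := by rintro rfl; norm_num at hw
  have hent : ∀ i j, (u • (t • xiM w) ^ e) i j
      = if (j : ℕ) = ((i : ℕ) + b) % 3 then (w ^ (i : ℕ)) ^ a else 0 := by
    intro i j; rw [h, xi_mono w a b hb]
  have hcube : xiM w ^ 3 = (3 : ℂ) • (xiM2 w * xiM w) := by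
    rw [pow_succ, pow_two, xiM_sq w hw, smul_mul_assoc]
  have hsq : xiM w ^ 2 = (3 : ℂ) • xiM2 w := by rw [pow_two, xiM_sq w hw]
  have hw2 : w ^ 2 ≠ 1 := by
    intro h2; apply hw1; linear_combination h3 - w * h2
  interval_cases e
  · have h00 := hent 0 0
    have h11 := hent 1 1
    interval_cases b
    · simp at h00 h11
      interval_cases a
      · simp
      · exact absurd (by simpa [h00] using h11.symm) hw1
      · exact absurd (by simpa [h00] using h11.symm) hw2
    · simp [hu] at h00
    · simp [hu] at h00
  · exfalso
    have h00 := hent 0 0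
    have h02 := hent 0 2
    interval_cases b <;> simp [xiM, hu, ht, hw0] at h00 h02
  · exfalso
    rw [smul_pow, hsq] at hent
    have h02 := hent 0 2
    have h11 := hent 1 1
    interval_cases b <;> simp [xiM2, hu, ht, hw0] at h02 h11
  · exfalso
    rw [smul_pow, hcube] at hent
    have h00 := hent 0 0
    have h02 := hent 0 2
    interval_cases b <;>
      simp [xiM, xiM2, Matrix.mul_apply, Fin.sum_univ_three, hu, ht, hw0] at h00 h02

end MatrixPart

/-- The group `Ξ(m, j)`, generated by `E` and `i·Q_{m,j}` inside `GL(3,ℂ)`,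
has order `3^{m+2}·2^j`. -/
theorem Xi_mj_order (m : ℕ) (hm : 0 < m) (j : ℕ) (hj : 2 ≤ j)
    (E Q : GL (Fin 3) ℂ)
    (hE : E.val = Ematrix) (hQ : Q.val = Complex.I • Qmatrix m j) :
    Nat.card ↥(Subgroup.closure ({E, Q} : Set (GL (Fin 3) ℂ)))
      = 3 ^ (m + 2) * 2 ^ j := by
  obtain ⟨p, rfl⟩ := Nat.exists_eq_add_of_le' hm
  obtain ⟨q, rfl⟩ := Nat.exists_eq_add_of_le' hj
  set w : ℂ := Complex.exp (2 * (Real.pi : ℂ) * Complex.I / 3) with hwdef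
  set x : ℂ := Complex.exp (2 * (Real.pi : ℂ) * Complex.I / ((3 : ℂ) ^ (p + 1) * (2 : ℂ) ^ (q + 2)))
    with hxdef
  set K : ℕ := 3 ^ (p + 1) * 2 ^ q with hKdef
  have hK : 0 < K := by positivity
  have hwp : IsPrimitiveRoot w 3 := by
    have := Complex.isPrimitiveRoot_exp 3 (by norm_num)
    simpa using this
  have hw : w ^ 2 + w + 1 = 0 := by
    have := hwp.geom_sum_eq_zero (by norm_num)
    simp [Finset.sum_range_succ] at this
    linear_combination this
  have hx4 : x ^ 4 = Complex.exp (2 * (Real.pi : ℂ) * Complex.I / (K : ℂ)) := by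
    rw [hxdef, ← Complex.exp_nat_mul]
    congr 1
    rw [hKdef]
    push_cast
    field_simp
    ring
  have hprim : IsPrimitiveRoot (x ^ 4) K := by
    rw [hx4]; exact Complex.isPrimitiveRoot_exp K hK.ne'
  have hx0 : x ≠ 0 := Complex.exp_ne_zero _
  have hwr : w = (x ^ 4) ^ (3 ^ p * 2 ^ q) := by
    rw [hx4, ← Complex.exp_nat_mul, hwdef]
    congr 1
    rw [hKdef]
    push_cast
    field_simp
    ring
  have hs : ((Real.sqrt 3 : ℝ) : ℂ) ^ 2 = 3 := by
    rw [← Complex.ofReal_pow, Real.sq_sqrt (by norm_num)]; norm_num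
  have hs0 : ((Real.sqrt 3 : ℝ) : ℂ) ≠ 0 := by
    intro h; rw [h] at hs; norm_num at hs
  set t : ℂ := x / ((Real.sqrt 3 : ℝ) : ℂ) with htdef
  have ht0 : t ≠ 0 := div_ne_zero hx0 hs0
  have ht2 : t ^ 2 * 3 = x ^ 2 := by
    rw [htdef, div_pow, hs]; field_simp
  have hQv : Q.val = t • xiM w := by
    rw [hQ, Qmatrix, smul_smul, ← hwdef, ← hxdef]
    rw [show Complex.I * (-Complex.I * x / ((Real.sqrt 3 : ℝ) : ℂ)) = t by
      rw [htdef]; linear_combination (-x / ((Real.sqrt 3 : ℝ) : ℂ)) * Complex.I_mul_I]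
    rfl
  let cu : ℂˣ := Units.mk0 (x ^ 4) (pow_ne_zero 4 hx0)
  let sc : ℂˣ →* GL (Fin 3) ℂ := Units.map (Matrix.scalar (Fin 3)).toMonoidHom
  have hscv : ∀ u : ℂˣ, (sc u).val = (u : ℂ) • (1 : Matrix (Fin 3) (Fin 3) ℂ) := by
    intro u
    simp [sc, Matrix.smul_one_eq_diagonal]
  have hcv : ∀ n : ℕ, ((sc cu) ^ n).val = ((x ^ 4) ^ n) • (1 : Matrix (Fin 3) (Fin 3) ℂ) := by
    intro n
    rw [← map_pow, hscv]; simp [cu]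
  have hscinj : Function.Injective sc := by
    intro u v huv
    have h := congrArg (fun g : GL (Fin 3) ℂ => g.val 0 0) huv
    simp only [hscv] at h
    ext
    simpa using h
  let Z : GL (Fin 3) ℂ := ⟨xiZ w, xiZ w ^ 2, by rw [← pow_succ', xiZ_cube w hw],
    by rw [← pow_succ, xiZ_cube w hw]⟩
  have hZv : Z.val = xiZ w := rfl
  have hwr2 : (x ^ 4) ^ (2 * (3 ^ p * 2 ^ q)) = w ^ 2 := by rw [hwr, mul_comm, pow_mul]
  have hsc1 : sc cu = sc cu ^ 1 := (pow_one _).symm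
  have main := xi_abstract (sc cu) Z E Q (3 ^ p * 2 ^ q) K hK
    (by
      rw [orderOf_injective sc hscinj, ← orderOf_units]
      exact hprim.eq_orderOf.symm)
    (by intro g; apply Units.ext; rw [Units.val_mul, Units.val_mul, hscv]; simp)
    (by apply Units.ext; rw [Units.val_pow_eq_pow_val, hE, xiE_cube]; rfl)
    (by apply Units.ext; rw [Units.val_pow_eq_pow_val, hZv, xiZ_cube w hw]; rfl)
    (by
      apply Units.ext
      simp only [Units.val_mul, hcv, hE, hZv, ← hwr]
      rw [xiE_Z w hw]; simp)
    (by
      apply Units.ext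
      simp only [Units.val_mul, hcv, hE, hZv, ← hwr, hQv]
      rw [smul_mul_assoc, xiM_Z w hw]; simp [smul_smul, mul_comm])
    (by
      apply Units.ext
      simp only [Units.val_mul, hcv, hE, hZv, hwr2, hQv]
      rw [smul_mul_assoc, xiM_E w hw]; simp [smul_smul, mul_comm])
    (by
      apply Units.ext
      rw [Units.val_pow_eq_pow_val, hcv, hQv, pow_add, pow_one, hwr2, smul_pow,
        show xiM w ^ 4 = (xiM w * xiM w) * (xiM w * xiM w) by simp only [pow_succ, pow_zero, one_mul, mul_assoc],
        xiM_sq w hw, smul_mul_smul_comm, xiM2_sq, smul_smul, smul_smul]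
      congr 1
      linear_combination w ^ 2 * (t ^ 2 * 3 + x ^ 2) * ht2)
    (by
      intro n a b e ha hb he h
      have h' := congrArg Units.val h
      simp only [Units.val_mul, hcv, Units.val_pow_eq_pow_val, hE, hZv, hQv] at h'
      rw [smul_mul_assoc, one_mul] at h'
      exact xi_indep w _ t hw (pow_ne_zero n (pow_ne_zero 4 hx0)) ht0 a b e ha hb he h')
  rw [main, hKdef]
  ring
end

section
/- Let m be a positive integer and let j ≥ 2 be an integer. Then the subgroup of GL(3,ℂ) generated by E, K and Q_{m,j} (this is the group Π(m, j)) has order 3^{m+2}·2^{j+2}. -/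
open Matrix

/-- The matrix `K = (−i/√3)·[[1, 1, 1], [1, ω, ω²], [1, ω², ω]]`, where `ω = exp(2πi/3)`. -/
noncomputable def Kmatrix : Matrix (Fin 3) (Fin 3) ℂ :=
  (-Complex.I / (Real.sqrt 3 : ℂ)) •
    (!![1, 1, 1;
        1, Complex.exp (2 * (Real.pi : ℂ) * Complex.I / 3),
          Complex.exp (2 * (Real.pi : ℂ) * Complex.I / 3) ^ 2;
        1, Complex.exp (2 * (Real.pi : ℂ) * Complex.I / 3) ^ 2,
          Complex.exp (2 * (Real.pi : ℂ) * Complex.I / 3)] :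
      Matrix (Fin 3) (Fin 3) ℂ)

section abstractpart
variable {G : Type*} [Group G]

theorem pi_normal (S : Set G) (g : G) [Finite (Subgroup.closure S)]
    (hn : ∀ s ∈ S, g * s * g⁻¹ ∈ Subgroup.closure S) :
    g ∈ Subgroup.normalizer (Subgroup.closure S : Set G) := by
  have h1 : ∀ x ∈ Subgroup.closure S, g * x * g⁻¹ ∈ Subgroup.closure S := by
    intro x hx
    have : Subgroup.closure S ≤ (Subgroup.closure S).comap (MulAut.conj g).toMonoidHom := by
      rw [Subgroup.closure_le]
      intro s hs
      simpa using hn s hs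
    simpa using this hx
  have hfin : Finite (Subgroup.closure S : Set G) := ‹_›
  rw [Subgroup.mem_normalizer_iff]
  intro x
  refine ⟨h1 x, fun hx => ?_⟩
  let f : Subgroup.closure S → Subgroup.closure S := fun a => ⟨g * a * g⁻¹, h1 a a.2⟩
  have hf : Function.Injective f := by
    intro a b hab
    have := congrArg Subtype.val hab
    exact Subtype.ext (mul_left_cancel (mul_right_cancel this))
  obtain ⟨a, ha⟩ := (Finite.injective_iff_surjective.mp hf) ⟨_, hx⟩
  have := congrArg Subtype.val ha
  have h2 : (a : G) = x := by simpa [f] using this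
  exact h2 ▸ a.2

theorem pi_decomp (S : Set G) (g : G) (p : ℕ) (hp : 0 < p) [Finite (Subgroup.closure S)]
    (hn : ∀ s ∈ S, g * s * g⁻¹ ∈ Subgroup.closure S)
    (hpow : g ^ p ∈ Subgroup.closure S) (x : G) (hx : x ∈ Subgroup.closure (insert g S)) :
    ∃ a ∈ Subgroup.closure S, ∃ k < p, x = a * g ^ k := by
  have hN := pi_normal S g hn
  have hN' : Subgroup.zpowers g ≤ Subgroup.normalizer (Subgroup.closure S : Set G) := by
    rwa [Subgroup.zpowers_le]
  have hx' : x ∈ Subgroup.closure S ⊔ Subgroup.zpowers g := by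
    rw [Set.insert_eq, Subgroup.closure_union, ← Subgroup.zpowers_eq_closure, sup_comm] at hx
    exact hx
  rw [← SetLike.mem_coe, Subgroup.coe_mul_of_right_le_normalizer_left _ _ hN'] at hx'
  obtain ⟨a, ha, b, ⟨n, rfl⟩, rfl⟩ := hx'
  have hp0 : (p : ℤ) ≠ 0 := by exact_mod_cast hp.ne'
  refine ⟨a * (g ^ p) ^ (n / p), mul_mem ha (zpow_mem hpow _), (n % p).toNat, ?_, ?_⟩
  · have := Int.emod_lt_of_pos n (by exact_mod_cast hp : (0 : ℤ) < p)
    have := Int.emod_nonneg n hp0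
    omega
  · have h0 := Int.emod_nonneg n hp0
    have : g ^ (n % p).toNat = g ^ (n % p) := by
      rw [← zpow_natCast, Int.toNat_of_nonneg h0]
    rw [this, mul_assoc, ← zpow_natCast g p, ← _root_.zpow_mul, ← _root_.zpow_add, Int.mul_ediv_add_emod]

theorem pi_step (S : Set G) (g : G) (p : ℕ) (hp : p.Prime) [Finite (Subgroup.closure S)]
    (hn : ∀ s ∈ S, g * s * g⁻¹ ∈ Subgroup.closure S)
    (hpow : g ^ p ∈ Subgroup.closure S) (hg : g ∉ Subgroup.closure S) :
    Nat.card (Subgroup.closure (insert g S)) = p * Nat.card (Subgroup.closure S) := by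
  have hle : Subgroup.closure S ≤ Subgroup.closure (insert g S) :=
    Subgroup.closure_mono (Set.subset_insert _ _)
  have hgm : g ∈ Subgroup.closure (insert g S) := Subgroup.subset_closure (Set.mem_insert _ _)
  let f : Fin p × Subgroup.closure S → Subgroup.closure (insert g S) := fun u =>
    ⟨u.2 * g ^ (u.1 : ℕ), mul_mem (hle u.2.2) (pow_mem hgm _)⟩
  have key : ∀ k : ℤ, g ^ k ∈ Subgroup.closure S → (p : ℤ) ∣ k := by
    intro k hk
    by_contra hnd
    have hc : IsCoprime (p : ℤ) k :=
      (Nat.prime_iff_prime_int.mp hp).coprime_iff_not_dvd.mpr hnd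
    obtain ⟨u, v, huv⟩ := hc
    apply hg
    have : g = (g ^ (p : ℤ)) ^ u * (g ^ k) ^ v := by
      rw [← _root_.zpow_mul, ← _root_.zpow_mul, ← _root_.zpow_add, mul_comm _ u, mul_comm k v, huv, zpow_one]
    rw [this]
    exact mul_mem (zpow_mem (by simpa using hpow) _) (zpow_mem hk _)
  have hf : Function.Bijective f := by
    constructor
    · rintro ⟨i, a⟩ ⟨j, b⟩ hab
      have h := congrArg Subtype.val hab
      simp only [f] at h
      have h2 : g ^ ((i : ℤ) - (j : ℤ)) = (a : G)⁻¹ * b := by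
        rw [_root_.zpow_sub, zpow_natCast, zpow_natCast, mul_inv_eq_iff_eq_mul, mul_assoc, ← h]
        group
      have h3 := key _ (h2 ▸ mul_mem (inv_mem a.2) b.2)
      have hij : i = j := by
        have hi := i.2
        have hj := j.2
        have := Int.eq_zero_of_abs_lt_dvd h3 (by rw [abs_lt]; omega)
        apply Fin.ext; omega
      subst hij
      have : (a : G) = b := mul_right_cancel h
      rw [Subtype.ext this]
    · rintro ⟨x, hx⟩
      obtain ⟨a, ha, k, hk, rfl⟩ := pi_decomp S g p hp.pos hn hpow x hx
      exact ⟨(⟨k, hk⟩, ⟨a, ha⟩), rfl⟩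
  rw [← Nat.card_eq_of_bijective f hf, Nat.card_prod, Nat.card_eq_fintype_card, Fintype.card_fin]

theorem pi_abstract (z w D E K Q : G) (hz : z ∈ Subgroup.center G) (hzo : 0 < orderOf z)
    (hw : w ∈ Subgroup.zpowers z) (hD : D ^ 3 = 1) (hE : E ^ 3 = 1) (hK : K ^ 4 = 1)
    (hED : E * D = w * D * E) (hKD : K * D = E * K) (hKE : K * E = D ^ 2 * K)
    (hQD : Q * D = E * D * Q) (hQE : Q * E = E ^ 2 * D * Q)
    (hQK : Q * K = w ^ 2 * E * D * K ^ 3 * Q) (hQQ : Q ^ 2 = z * E * D ^ 2 * K ^ 2)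
    (hne : E * D ≠ D * E) :
    Nat.card (Subgroup.closure ({E, K, Q} : Set G)) = 72 * orderOf z := by
  have hzc : ∀ g, g * z = z * g := fun g => Subgroup.mem_center_iff.mp hz g
  have hwc : ∀ g, g * w = w * g := fun g => Subgroup.mem_center_iff.mp
    ((Subgroup.zpowers_le.mpr hz) hw) g
  have hPD : K ^ 2 * D = D ^ 2 * K ^ 2 := by
    rw [pow_two K, mul_assoc, hKD, ← mul_assoc, hKE]; simp only [mul_assoc]
  have hPE : K ^ 2 * E = E ^ 2 * K ^ 2 := by
    rw [pow_two K, mul_assoc, hKE, pow_two D, ← mul_assoc, ← mul_assoc, hKD, mul_assoc E, hKD]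
    simp only [pow_two, mul_assoc]
  have cz : ∀ g, g * z * g⁻¹ = z := fun g => by rw [hzc]; group
  -- the chain
  have e0 : Subgroup.closure ({z} : Set G) = Subgroup.zpowers z :=
    (Subgroup.zpowers_eq_closure z).symm
  have c0 : Nat.card (Subgroup.closure ({z} : Set G)) = orderOf z := by
    rw [e0, Nat.card_zpowers]
  have f0 : Finite (Subgroup.closure ({z} : Set G)) :=
    Nat.finite_of_card_ne_zero (by omega)
  have w0 : w ∈ Subgroup.closure ({z} : Set G) := e0 ▸ hw
  have i01 : Subgroup.closure ({z} : Set G) ≤ Subgroup.closure ({D, z} : Set G) :=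
    Subgroup.closure_mono (by intro x; simp; tauto)
  have i12 : Subgroup.closure ({D, z} : Set G) ≤ Subgroup.closure ({E, D, z} : Set G) :=
    Subgroup.closure_mono (by intro x; simp; tauto)
  have i23 : Subgroup.closure ({E, D, z} : Set G) ≤ Subgroup.closure ({K ^ 2, E, D, z} : Set G) :=
    Subgroup.closure_mono (by intro x; simp; tauto)
  have i34 : Subgroup.closure ({K ^ 2, E, D, z} : Set G) ≤
      Subgroup.closure ({K, K ^ 2, E, D, z} : Set G) :=
    Subgroup.closure_mono (by intro x; simp; tauto)
  have z0 : z ∈ Subgroup.closure ({z} : Set G) := Subgroup.subset_closure (by simp)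
  have D1 : D ∈ Subgroup.closure ({D, z} : Set G) := Subgroup.subset_closure (by simp)
  have E2 : E ∈ Subgroup.closure ({E, D, z} : Set G) := Subgroup.subset_closure (by simp)
  have P3 : K ^ 2 ∈ Subgroup.closure ({K ^ 2, E, D, z} : Set G) :=
    Subgroup.subset_closure (by simp)
  have K4 : K ∈ Subgroup.closure ({K, K ^ 2, E, D, z} : Set G) :=
    Subgroup.subset_closure (by simp)
  -- step 1
  have n0 : D ∉ Subgroup.closure ({z} : Set G) := by
    intro h
    rw [e0] at h
    exact hne (Subgroup.mem_center_iff.mp ((Subgroup.zpowers_le.mpr hz) h) E)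
  have c1 := pi_step ({z} : Set G) D 3 Nat.prime_three (by simp [cz, z0]) (by simp [hD, one_mem]) n0
  have f1 : Finite (Subgroup.closure ({D, z} : Set G)) :=
    Nat.finite_of_card_ne_zero (by omega)
  -- step 2
  have com1 : ∀ a ∈ Subgroup.closure ({D, z} : Set G), a * D = D * a := by
    intro a ha
    have : Subgroup.closure ({D, z} : Set G) ≤ Subgroup.centralizer {D} := by
      rw [Subgroup.closure_le]
      rintro x (rfl | rfl)
      · simp [Subgroup.mem_centralizer_iff]
      · simp [Subgroup.mem_centralizer_iff, hzc]
    have := this ha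
    rw [Subgroup.mem_centralizer_iff] at this
    exact (this D rfl).symm
  have n1 : E ∉ Subgroup.closure ({D, z} : Set G) := fun h => hne (com1 E h)
  have cED : E * D * E⁻¹ = w * D := by rw [mul_inv_eq_iff_eq_mul, hED]
  have g1 : ∀ s ∈ ({D, z} : Set G), E * s * E⁻¹ ∈ Subgroup.closure ({D, z} : Set G) := by
    rintro x (rfl | rfl)
    · rw [cED]; exact mul_mem (i01 w0) D1
    · rw [cz]; exact i01 z0
  have c2 := pi_step ({D, z} : Set G) E 3 Nat.prime_three g1 (by simp [hE, one_mem]) n1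
  have f2 : Finite (Subgroup.closure ({E, D, z} : Set G)) :=
    Nat.finite_of_card_ne_zero (by omega)
  -- step 3
  have cPD : K ^ 2 * D * (K ^ 2)⁻¹ = D ^ 2 := by rw [mul_inv_eq_iff_eq_mul, hPD]
  have cPE : K ^ 2 * E * (K ^ 2)⁻¹ = E ^ 2 := by rw [mul_inv_eq_iff_eq_mul, hPE]
  have hEkD : ∀ k : ℕ, E ^ k * D = w ^ k * D * E ^ k := by
    intro k
    induction k with
    | zero => simp
    | succ k ih =>
      rw [pow_succ E, mul_assoc, hED, ← mul_assoc, ← mul_assoc, hwc, mul_assoc w, ih, pow_succ' w]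
      simp only [mul_assoc]
  have n2 : K ^ 2 ∉ Subgroup.closure ({E, D, z} : Set G) := by
    intro h
    obtain ⟨a, ha, k, -, hk⟩ := pi_decomp ({D, z} : Set G) E 3 (by norm_num) g1
      (by simp [hE, one_mem]) _ h
    have hwk : ∀ g, g * w ^ k = w ^ k * g := fun g => (Commute.pow_right (show Commute g w from hwc g) k)
    have h1 : K ^ 2 * D = w ^ k * D * K ^ 2 := by
      rw [hk, mul_assoc, hEkD, ← mul_assoc, ← mul_assoc, hwk, mul_assoc _ a D, com1 a ha]
      simp only [mul_assoc]
    rw [hPD] at h1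
    have h2 := mul_right_cancel h1
    rw [pow_two] at h2
    have h3 := mul_right_cancel h2
    exact n0 (h3 ▸ pow_mem w0 k)
  have g2 : ∀ s ∈ ({E, D, z} : Set G), K ^ 2 * s * (K ^ 2)⁻¹ ∈
      Subgroup.closure ({E, D, z} : Set G) := by
    rintro x (rfl | rfl | rfl)
    · rw [cPE]; exact pow_mem E2 2
    · rw [cPD]; exact pow_mem (i12 D1) 2
    · rw [cz]; exact i12 (i01 z0)
  have c3 := pi_step ({E, D, z} : Set G) (K ^ 2) 2 Nat.prime_two g2
    (by rw [← pow_mul, hK]; exact one_mem _) n2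
  have f3 : Finite (Subgroup.closure ({K ^ 2, E, D, z} : Set G)) :=
    Nat.finite_of_card_ne_zero (by omega)
  -- step 4
  have nor3 : ∀ x ∈ Subgroup.closure ({K ^ 2, E, D, z} : Set G),
      x * D * x⁻¹ ∈ Subgroup.closure ({D, z} : Set G) := by
    intro x hx
    have : Subgroup.closure ({K ^ 2, E, D, z} : Set G) ≤
        Subgroup.normalizer (Subgroup.closure ({D, z} : Set G) : Set G) := by
      rw [Subgroup.closure_le]
      rintro x (rfl | rfl | rfl | rfl)
      · apply pi_normal
        rintro x (rfl | rfl)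
        · rw [cPD]; exact pow_mem D1 2
        · rw [cz]; exact i01 z0
      · exact pi_normal _ _ g1
      · exact Subgroup.le_normalizer D1
      · exact Subgroup.le_normalizer (i01 z0)
    exact (Subgroup.mem_normalizer_iff.mp (this hx) D).mp D1
  have cKD : K * D * K⁻¹ = E := by rw [mul_inv_eq_iff_eq_mul, hKD]
  have cKE : K * E * K⁻¹ = D ^ 2 := by rw [mul_inv_eq_iff_eq_mul, hKE]
  have n3 : K ∉ Subgroup.closure ({K ^ 2, E, D, z} : Set G) := by
    intro h
    have := nor3 K h
    rw [cKD] at this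
    exact n1 this
  have g3 : ∀ s ∈ ({K ^ 2, E, D, z} : Set G), K * s * K⁻¹ ∈
      Subgroup.closure ({K ^ 2, E, D, z} : Set G) := by
    rintro x (rfl | rfl | rfl | rfl)
    · have : K * K ^ 2 * K⁻¹ = K ^ 2 := by group
      rw [this]; exact P3
    · rw [cKE]; exact pow_mem (i23 (i12 D1)) 2
    · rw [cKD]; exact i23 E2
    · rw [cz]; exact i23 (i12 (i01 z0))
  have c4 := pi_step ({K ^ 2, E, D, z} : Set G) K 2 Nat.prime_two g3 P3 n3
  have f4 : Finite (Subgroup.closure ({K, K ^ 2, E, D, z} : Set G)) :=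
    Nat.finite_of_card_ne_zero (by omega)
  -- step 5
  have cQD : Q * D * Q⁻¹ = E * D := by rw [mul_inv_eq_iff_eq_mul, hQD]
  have cQE : Q * E * Q⁻¹ = E ^ 2 * D := by rw [mul_inv_eq_iff_eq_mul, hQE]
  have cQK : Q * K * Q⁻¹ = w ^ 2 * E * D * K ^ 3 := by rw [mul_inv_eq_iff_eq_mul, hQK]
  have E4 := i34 (i23 E2)
  have D4 := i34 (i23 (i12 D1))
  have w4 := i34 (i23 (i12 (i01 w0)))
  have z4 := i34 (i23 (i12 (i01 z0)))
  have n4 : Q ∉ Subgroup.closure ({K, K ^ 2, E, D, z} : Set G) := by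
    intro h
    obtain ⟨a, ha, k, hk2, hk⟩ := pi_decomp ({K ^ 2, E, D, z} : Set G) K 2 (by norm_num) g3
      P3 _ h
    interval_cases k
    · rw [pow_zero, mul_one] at hk
      subst hk
      have := nor3 Q ha
      rw [cQD] at this
      exact n1 ((Subgroup.mul_mem_cancel_right _ D1).mp this)
    · rw [pow_one] at hk
      have h1 := nor3 a ha
      have h2 : a * D ^ 2 * a⁻¹ ∈ Subgroup.closure ({D, z} : Set G) := by
        have : a * D ^ 2 * a⁻¹ = (a * D * a⁻¹) ^ 2 := by rw [conj_pow]
        rw [this]; exact pow_mem h1 2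
      have h3 : a * D ^ 2 * a⁻¹ = E ^ 2 * D := by
        rw [← cQE, ← cKE, hk]; group
      rw [h3] at h2
      have h4 := (Subgroup.mul_mem_cancel_right _ D1).mp h2
      have h5 : E = (E ^ 2) ^ 2 := by
        rw [← pow_mul, show 2 * 2 = 3 + 1 from rfl, pow_succ, hE, one_mul]
      exact n1 (h5 ▸ pow_mem h4 2)
  have k4 : w ^ 2 * E * D * K ^ 3 ∈ Subgroup.closure ({K, K ^ 2, E, D, z} : Set G) :=
    mul_mem (mul_mem (mul_mem (pow_mem w4 2) E4) D4) (pow_mem K4 3)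
  have c5 := pi_step ({K, K ^ 2, E, D, z} : Set G) Q 2 Nat.prime_two (by
    rintro x (rfl | rfl | rfl | rfl | rfl)
    · rw [cQK]; exact k4
    · rw [← conj_pow, cQK]; exact pow_mem k4 2
    · rw [cQE]; exact mul_mem (pow_mem E4 2) D4
    · rw [cQD]; exact mul_mem E4 D4
    · rw [cz]; exact z4)
    (by rw [hQQ]; exact mul_mem (mul_mem (mul_mem z4 E4) (pow_mem D4 2)) (pow_mem K4 2)) n4
  have heq : Subgroup.closure ({E, K, Q} : Set G) =
      Subgroup.closure ({Q, K, K ^ 2, E, D, z} : Set G) := by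
    apply le_antisymm
    · exact Subgroup.closure_mono (by intro x; simp; tauto)
    · have mE : E ∈ Subgroup.closure ({E, K, Q} : Set G) := Subgroup.subset_closure (by simp)
      have mK : K ∈ Subgroup.closure ({E, K, Q} : Set G) := Subgroup.subset_closure (by simp)
      have mQ : Q ∈ Subgroup.closure ({E, K, Q} : Set G) := Subgroup.subset_closure (by simp)
      have mD : D ∈ Subgroup.closure ({E, K, Q} : Set G) := by
        have : D = K⁻¹ * E * K := by rw [← cKD]; group
        rw [this]; exact mul_mem (mul_mem (inv_mem mK) mE) mK
      have mz : z ∈ Subgroup.closure ({E, K, Q} : Set G) := by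
        have : z = Q ^ 2 * (K ^ 2)⁻¹ * (D ^ 2)⁻¹ * E⁻¹ := by rw [hQQ]; group
        rw [this]
        exact mul_mem (mul_mem (mul_mem (pow_mem mQ 2) (inv_mem (pow_mem mK 2)))
          (inv_mem (pow_mem mD 2))) (inv_mem mE)
      rw [Subgroup.closure_le]
      rintro x (rfl | rfl | rfl | rfl | rfl | rfl)
      exacts [mQ, mK, pow_mem mK 2, mE, mD, mz]
  rw [heq, c5, c4, c3, c2, c1, c0]
  ring

end abstractpart

set_option maxHeartbeats 4000000 in
theorem pi_mat_rel (w s x : ℂ) (hw : w ^ 2 + w + 1 = 0) (hs : 3 * s = -(1 + 2 * w)) :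
    let D : Matrix (Fin 3) (Fin 3) ℂ := !![1, 0, 0; 0, w, 0; 0, 0, w ^ 2]
    let E : Matrix (Fin 3) (Fin 3) ℂ := !![0, 1, 0; 0, 0, 1; 1, 0, 0]
    let K : Matrix (Fin 3) (Fin 3) ℂ := s • !![1, 1, 1; 1, w, w ^ 2; 1, w ^ 2, w]
    let Q : Matrix (Fin 3) (Fin 3) ℂ :=
      (s * x) • !![1, w ^ 2, w ^ 2; w ^ 2, w ^ 2, 1; 1, w, 1]
    D * (D * D) = 1 ∧ E * (E * E) = 1 ∧ (K * K) * (K * K) = 1 ∧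
    E * D = w • (D * E) ∧ K * D = E * K ∧ K * E = D * D * K ∧
    Q * D = E * D * Q ∧ Q * E = E * E * D * Q ∧
    Q * K = (w ^ 2) • (E * D * (K * K * K) * Q) ∧ 
    Q * Q = (x ^ 2) • (E * (D * D) * (K * K)) := by
  intro D E K Q
  have hs' : s = -(1 + 2 * w) / 3 := by linear_combination hs / 3
  have hw3 : w ^ 3 = 1 := by linear_combination (w - 1) * hw
  have hss : s ^ 2 = -1 / 3 := by rw [hs']; linear_combination (4 / 9) * hw
  have hKK : K * K = !![-1, 0, 0; 0, 0, -1; 0, -1, 0] := by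
    ext i j
    fin_cases i <;> fin_cases j <;> simp [K, Matrix.mul_apply, Fin.sum_univ_three] <;> grind
  have hKKKK : (K * K) * (K * K) = 1 := by
    rw [hKK]
    ext i j
    fin_cases i <;> fin_cases j <;> simp [Matrix.mul_apply, Fin.sum_univ_three]
  have hQQ : Q * Q = (x ^ 2) • !![0, 0, -w ^ 2; 0, -w, 0; -1, 0, 0] := by
    ext i j
    fin_cases i <;> fin_cases j <;> simp [Q, Matrix.mul_apply, Fin.sum_univ_three] <;> grind
  rw [hKKKK, hKK, hQQ]
  refine ⟨?_, ?_, rfl, ?_, ?_, ?_, ?_, ?_, ?_, ?_⟩ <;>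
  · ext i j
    fin_cases i <;> fin_cases j <;>
      simp [D, E, K, Q, Matrix.mul_apply, Fin.sum_univ_three] <;> grind

/-- The group `Π(m, j)`, generated by `E`, `K` and `Q_{m,j}` inside `GL(3,ℂ)`,
has order `3^{m+2}·2^{j+2}`. -/
theorem Pi_mj_order (m : ℕ) (hm : 0 < m) (j : ℕ) (hj : 2 ≤ j)
    (E K Q : GL (Fin 3) ℂ)
    (hE : E.val = Ematrix) (hK : K.val = Kmatrix) (hQ : Q.val = Qmatrix m j) :
    Nat.card ↥(Subgroup.closure ({E, K, Q} : Set (GL (Fin 3) ℂ)))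
      = 3 ^ (m + 2) * 2 ^ (j + 2) := by
  obtain ⟨a, rfl⟩ : ∃ a, m = a + 1 := ⟨m - 1, by omega⟩
  obtain ⟨b, rfl⟩ : ∃ b, j = b + 1 := ⟨j - 1, by omega⟩
  obtain ⟨w, hwdef⟩ : ∃ w, w = Complex.exp (2 * (Real.pi : ℂ) * Complex.I / 3) := ⟨_, rfl⟩
  obtain ⟨x, hxdef⟩ : ∃ x, x = Complex.exp (2 * (Real.pi : ℂ) * Complex.I /
    ((3 : ℂ) ^ (a + 1) * (2 : ℂ) ^ (b + 1))) := ⟨_, rfl⟩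
  obtain ⟨s, hsdef⟩ : ∃ s : ℂ, s = -Complex.I / (Real.sqrt 3 : ℂ) := ⟨_, rfl⟩
  have hwp : IsPrimitiveRoot w 3 := by
    have := Complex.isPrimitiveRoot_exp 3 (by norm_num)
    rw [hwdef]; exact_mod_cast this
  have hxp : IsPrimitiveRoot x (3 ^ (a + 1) * 2 ^ (b + 1)) := by
    have := Complex.isPrimitiveRoot_exp (3 ^ (a + 1) * 2 ^ (b + 1)) (by positivity)
    rw [hxdef]; exact_mod_cast this
  have hx2 : IsPrimitiveRoot (x ^ 2) (3 ^ (a + 1) * 2 ^ b) :=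
    hxp.pow (by positivity) (by ring)
  have hxw : (x ^ 2) ^ (3 ^ a * 2 ^ b) = w := by
    rw [hxdef, hwdef, ← Complex.exp_nat_mul, ← Complex.exp_nat_mul]
    congr 1
    push_cast
    field_simp
    ring
  have hw2 : w ^ 2 + w + 1 = 0 := by
    have h1 : w ^ 3 = 1 := hwp.pow_eq_one
    have h2 : w ≠ 1 := hwp.ne_one (by norm_num)
    have : (w - 1) * (w ^ 2 + w + 1) = 0 := by linear_combination h1
    exact (mul_eq_zero.mp this).resolve_left (sub_ne_zero.mpr h2)
  have hs3 : 3 * s = -(1 + 2 * w) := by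
    have h3 : ((Real.sqrt 3 : ℝ) : ℂ) ^ 2 = 3 := by
      rw [← Complex.ofReal_pow, Real.sq_sqrt (by norm_num)]; norm_num
    have h30 : ((Real.sqrt 3 : ℝ) : ℂ) ≠ 0 := by
      intro h; rw [h] at h3; norm_num at h3
    have hw' : w = -1 / 2 + (Real.sqrt 3 : ℂ) / 2 * Complex.I := by
      have e : 2 * (Real.pi : ℂ) * Complex.I / 3 =
        ((Real.pi - Real.pi / 3 : ℝ) : ℂ) * Complex.I := by push_cast; ring
      rw [hwdef, e, Complex.exp_mul_I, ← Complex.ofReal_cos, ← Complex.ofReal_sin,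
        Real.cos_pi_sub, Real.sin_pi_sub, Real.cos_pi_div_three, Real.sin_pi_div_three]
      push_cast; ring
    rw [hsdef, hw']
    field_simp
    linear_combination (Complex.I) * h3
  have hx0 : x ^ 2 ≠ 0 := by rw [hxdef]; exact pow_ne_zero _ (Complex.exp_ne_zero _)
  have hE' : E.val = !![0, 1, 0; 0, 0, 1; 1, 0, 0] := hE
  have hK' : K.val = s • !![1, 1, 1; 1, w, w ^ 2; 1, w ^ 2, w] := by
    rw [hK, Kmatrix, ← hwdef, ← hsdef]
  have hQ' : Q.val = (s * x) • !![1, w ^ 2, w ^ 2; w ^ 2, w ^ 2, 1; 1, w, 1] := by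
    rw [hQ, Qmatrix, ← hwdef, ← hxdef]
    congr 1
    rw [hsdef]; ring
  obtain ⟨r1, r2, r3, r4, r5, r6, r7, r8, r9, r10⟩ := pi_mat_rel w s x hw2 hs3
  rw [← hE'] at r2 r4 r5 r6 r7 r8 r9 r10
  rw [← hK'] at r3 r5 r6 r9 r10
  rw [← hQ'] at r7 r8 r9 r10
  let D : GL (Fin 3) ℂ := ⟨!![1, 0, 0; 0, w, 0; 0, 0, w ^ 2],
    !![1, 0, 0; 0, w, 0; 0, 0, w ^ 2] * !![1, 0, 0; 0, w, 0; 0, 0, w ^ 2], r1,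
    by rw [Matrix.mul_assoc]; exact r1⟩
  let φ : ℂˣ →* GL (Fin 3) ℂ := Units.map (Matrix.scalar (Fin 3)).toMonoidHom
  have hφi : Function.Injective φ := by
    intro u v h
    have h1 := congrArg (fun g : GL (Fin 3) ℂ => g.val 0 0) h
    simpa [φ, Units.ext_iff] using h1
  have hφ : ∀ u : ℂˣ, (φ u).val = (u : ℂ) • (1 : Matrix (Fin 3) (Fin 3) ℂ) := by
    intro u
    simp [φ, Matrix.smul_one_eq_diagonal]
  let u : ℂˣ := Units.mk0 (x ^ 2) hx0
  have hw0 : w ≠ 0 := hwp.ne_zero (by norm_num)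
  let v : ℂˣ := Units.mk0 w hw0
  have huv : u ^ (3 ^ a * 2 ^ b) = v := by
    apply Units.ext; simpa [u, v] using hxw
  have hou : orderOf (φ u) = 3 ^ (a + 1) * 2 ^ b := by
    rw [orderOf_injective φ hφi, ← orderOf_units]
    exact hx2.eq_orderOf.symm
  have main := pi_abstract (φ u) (φ v) D E K Q
    (by
      rw [Subgroup.mem_center_iff]
      intro g
      apply Units.ext
      simp [hφ])
    (by rw [hou]; positivity)
    (by rw [← huv, map_pow]; exact pow_mem (Subgroup.mem_zpowers _) _)
    (by apply Units.ext; rw [pow_succ', pow_two]; exact r1)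
    (by apply Units.ext; rw [pow_succ', pow_two]; exact r2)
    (by apply Units.ext; rw [show 4 = 2 * 2 from rfl, pow_mul, pow_two, pow_two]; exact r3)
    (by 
      apply Units.ext
      simp only [Units.val_mul, hφ, smul_mul_assoc, one_mul]
      exact r4)
    (by apply Units.ext; exact r5)
    (by apply Units.ext; rw [pow_two]; exact r6)
    (by apply Units.ext; exact r7)
    (by apply Units.ext; rw [pow_two]; exact r8)
    (by
      apply Units.ext
      rw [← map_pow, pow_succ K, pow_two K]
      simp only [Units.val_mul, hφ, smul_mul_assoc, one_mul]
      exact r9)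
    (by
      apply Units.ext
      rw [pow_two, pow_two, pow_two]
      simp only [Units.val_mul, hφ, smul_mul_assoc, one_mul]
      exact r10)
    (by
      intro h
      have h1 := congrArg (fun g : GL (Fin 3) ℂ => g.val 0 1) h
      simp [hE', D, Matrix.mul_apply, Fin.sum_univ_three] at h1
      exact hwp.ne_one (by norm_num) h1)
  rw [main, hou]
  ring
end
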